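/- arXiv:2209.09514 — 3 statements merged into one kernel-verified Lean document; each statement's English description precedes it below -/
import Mathlib

section
/- Let L and M be Lie superalgebras over a field of characteristic ≠ 2, 3 acting trivially on each other. Then (L ⊕ M) ⊗ (L ⊕ M) ≅ (L ⊗ L) ⊕ (L ⊗ M) ⊕ (M ⊗ L) ⊕ (M ⊗ M), where all tensor products are non-abelian tensor products of Lie superalgebras. -/
open Module Function TensorProduct

universe u v w x y z

/-- The sign `(-1)^(ab)` for degrees `a b : ZMod 2`, as an element of the field `F`. -/
def sgn (F : Type u) [Field F] (a b : ZMod 2) : F :=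
  if a = 1 ∧ b = 1 then -1 else 1

/-- A supermodule (ℤ/2-graded vector space) over `F`. -/
class SuperModule (F : Type u) (V : Type v) [Field F] [AddCommGroup V] [Module F V] where
  grade : ZMod 2 → Submodule F V
  isCompl_grade : IsCompl (grade 0) (grade 1)

/-- The graded piece of degree `a`. -/
abbrev gr (F : Type u) (V : Type v) [Field F] [AddCommGroup V] [Module F V]
    [s : SuperModule F V] (a : ZMod 2) : Submodule F V := s.grade a

/-- A Lie superalgebra structure on a supermodule. -/
class LieSuperAlgebra (F : Type u) (L : Type v) [Field F] [AddCommGroup L] [Module F L]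
    [SuperModule F L] where
  bracket : L →ₗ[F] L →ₗ[F] L
  bracket_grade : ∀ (a b : ZMod 2) (x y : L), x ∈ gr F L a → y ∈ gr F L b →
    bracket x y ∈ gr F L (a + b)
  skew : ∀ (a b : ZMod 2) (x y : L), x ∈ gr F L a → y ∈ gr F L b →
    bracket x y = -(sgn F a b) • bracket y x
  jacobi : ∀ (a b c : ZMod 2) (x y zz : L), x ∈ gr F L a → y ∈ gr F L b → zz ∈ gr F L c →
    sgn F a c • bracket x (bracket y zz) + sgn F b a • bracket y (bracket zz x)
      + sgn F c b • bracket zz (bracket x y) = 0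

/-- The bracket of a Lie superalgebra. -/
abbrev br (F : Type u) (L : Type v) [Field F] [AddCommGroup L] [Module F L] [SuperModule F L]
    [s : LieSuperAlgebra F L] : L →ₗ[F] L →ₗ[F] L := s.bracket

/-- A graded submodule. -/
def IsGradedSub (F : Type u) {V : Type v} [Field F] [AddCommGroup V] [Module F V]
    [SuperModule F V] (N : Submodule F V) : Prop :=
  N ≤ (N ⊓ gr F V 0) ⊔ (N ⊓ gr F V 1)

section LSADefs

variable (F : Type u) [Field F]
variable (L : Type v) [AddCommGroup L] [Module F L] [SuperModule F L] [LieSuperAlgebra F L]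

/-- The derived subalgebra `L² = [L, L]`. -/
def derivedSub : Submodule F L := Submodule.span F {t | ∃ x y : L, br F L x y = t}

/-- The center `Z(L)`. -/
def centerSub : Submodule F L := ⨅ x : L, LinearMap.ker ((br F L).flip x)

/-- The span of brackets `[A, B]` of two submodules. -/
def bracketSub (A B : Submodule F L) : Submodule F L :=
  Submodule.span F {t | ∃ x ∈ A, ∃ y ∈ B, br F L x y = t}

/-- Abelian Lie superalgebra. -/
def IsAbelianLSA : Prop := ∀ x y : L, br F L x y = 0

/-- The lower central series. -/
def lcs : ℕ → Submodule F L
  | 0 => ⊤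
  | n + 1 => Submodule.span F {t | ∃ x : L, ∃ y ∈ lcs n, br F L x y = t}

/-- Nilpotent Lie superalgebra. -/
def IsNilpotentLSA : Prop := ∃ n : ℕ, lcs F L n = ⊥

end LSADefs

/-- Homomorphism of Lie superalgebras: an even linear map preserving grading and bracket. -/
structure LieSuperHom (F : Type u) (L : Type v) (M : Type w) [Field F]
    [AddCommGroup L] [Module F L] [SuperModule F L] [LieSuperAlgebra F L]
    [AddCommGroup M] [Module F M] [SuperModule F M] [LieSuperAlgebra F M]
    extends L →ₗ[F] M where
  map_grade : ∀ (a : ZMod 2) (x : L), x ∈ gr F L a → toLinearMap x ∈ gr F M a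
  map_bracket : ∀ x y : L, toLinearMap (br F L x y) = br F M (toLinearMap x) (toLinearMap y)

/-- Isomorphism of Lie superalgebras. -/
def LSAIsomorphic (F : Type u) (L : Type v) (M : Type w) [Field F]
    [AddCommGroup L] [Module F L] [SuperModule F L] [LieSuperAlgebra F L]
    [AddCommGroup M] [Module F M] [SuperModule F M] [LieSuperAlgebra F M] : Prop :=
  ∃ f : LieSuperHom F L M, Function.Bijective f.toLinearMap

/-- `Q` is (a realization of) the quotient `L / L²`, i.e. the abelianization of `L`. -/
def IsQuotientByDerived (F : Type u) (L : Type v) (Q : Type w) [Field F]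
    [AddCommGroup L] [Module F L] [SuperModule F L] [LieSuperAlgebra F L]
    [AddCommGroup Q] [Module F Q] [SuperModule F Q] [LieSuperAlgebra F Q] : Prop :=
  ∃ f : LieSuperHom F L Q, Function.Surjective f.toLinearMap ∧
    LinearMap.ker f.toLinearMap = derivedSub F L

/-- An action of the Lie superalgebra `P` on the Lie superalgebra `M`. -/
structure LieSuperAction (F : Type u) (P : Type v) (M : Type w) [Field F]
    [AddCommGroup P] [Module F P] [SuperModule F P] [LieSuperAlgebra F P]
    [AddCommGroup M] [Module F M] [SuperModule F M] [LieSuperAlgebra F M] where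
  act : P →ₗ[F] M →ₗ[F] M
  act_grade : ∀ (a b : ZMod 2) (p : P) (m : M), p ∈ gr F P a → m ∈ gr F M b →
    act p m ∈ gr F M (a + b)
  act_bracket : ∀ (a b : ZMod 2) (p p' : P) (m : M), p ∈ gr F P a → p' ∈ gr F P b →
    act (br F P p p') m = act p (act p' m) - sgn F a b • act p' (act p m)
  act_lie : ∀ (a b : ZMod 2) (p : P) (m m' : M), p ∈ gr F P a → m ∈ gr F M b →
    act p (br F M m m') = br F M (act p m) m' + sgn F a b • br F M m (act p m')

/-- A trivial action. -/
def LieSuperAction.IsTrivial {F : Type u} {P : Type v} {M : Type w} [Field F]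
    [AddCommGroup P] [Module F P] [SuperModule F P] [LieSuperAlgebra F P]
    [AddCommGroup M] [Module F M] [SuperModule F M] [LieSuperAlgebra F M]
    (α : LieSuperAction F P M) : Prop := ∀ (p : P) (m : M), α.act p m = 0

/-- The trivial action of `P` on `M`. -/
def trivialAction (F : Type u) (P : Type v) (M : Type w) [Field F]
    [AddCommGroup P] [Module F P] [SuperModule F P] [LieSuperAlgebra F P]
    [AddCommGroup M] [Module F M] [SuperModule F M] [LieSuperAlgebra F M] :
    LieSuperAction F P M where
  act := 0
  act_grade := by
    intro a b p m _ _
    simp only [LinearMap.zero_apply]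
    exact (gr F M (a + b)).zero_mem
  act_bracket := by intro a b p p' m _ _; simp
  act_lie := by intro a b p m m' _ _; simp

/-- A Lie superpairing on `M × N` (relative to mutual actions) with values in the
Lie superalgebra `T`; these are exactly the defining relations of the non-abelian
tensor product `M ⊗ N`. -/
structure SuperPairing (F : Type u) (M : Type v) (N : Type w) (T : Type x) [Field F]
    [AddCommGroup M] [Module F M] [SuperModule F M] [LieSuperAlgebra F M]
    [AddCommGroup N] [Module F N] [SuperModule F N] [LieSuperAlgebra F N]
    [AddCommGroup T] [Module F T] [SuperModule F T] [LieSuperAlgebra F T]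
    (α : LieSuperAction F M N) (β : LieSuperAction F N M) where
  pair : M →ₗ[F] N →ₗ[F] T
  pair_grade : ∀ (a b : ZMod 2) (m : M) (n : N), m ∈ gr F M a → n ∈ gr F N b →
    pair m n ∈ gr F T (a + b)
  rel1 : ∀ (a b : ZMod 2) (m m' : M) (n : N), m ∈ gr F M a → m' ∈ gr F M b →
    pair (br F M m m') n = pair m (α.act m' n) - sgn F a b • pair m' (α.act m n)
  rel2 : ∀ (a b c : ZMod 2) (m : M) (n n' : N), m ∈ gr F M a → n ∈ gr F N b → n' ∈ gr F N c →
    pair m (br F N n n') = sgn F c (a + b) • pair (β.act n' m) n - sgn F a b • pair (β.act n m) n'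
  rel3 : ∀ (a b : ZMod 2) (m : M) (n : N) (m' : M) (n' : N), m ∈ gr F M a → n ∈ gr F N b →
    br F T (pair m n) (pair m' n') = - sgn F a b • pair (β.act n m) (α.act m' n')

/-- `T`, together with the pairing `p`, is (a realization of) the non-abelian tensor
product `M ⊗ N`: it satisfies the universal property among Lie superpairings. -/
def IsTensorProductLSA (F : Type u) (M : Type v) (N : Type w) (T : Type x) [Field F]
    [AddCommGroup M] [Module F M] [SuperModule F M] [LieSuperAlgebra F M]
    [AddCommGroup N] [Module F N] [SuperModule F N] [LieSuperAlgebra F N]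
    [AddCommGroup T] [Module F T] [SuperModule F T] [LieSuperAlgebra F T]
    (α : LieSuperAction F M N) (β : LieSuperAction F N M)
    (p : SuperPairing F M N T α β) : Prop :=
  ∀ (T' : Type (max u v w x)) [AddCommGroup T'] [Module F T'] [SuperModule F T']
    [LieSuperAlgebra F T'] (q : SuperPairing F M N T' α β),
    ∃! h : LieSuperHom F T T', ∀ (m : M) (n : N), h.toLinearMap (p.pair m n) = q.pair m n

/-- A Lie superpairing for the tensor square `L ⊗ L` (with adjoint actions):
the defining relations of the non-abelian tensor square. -/
structure TensorSqPairing (F : Type u) (L : Type v) (T : Type w) [Field F]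
    [AddCommGroup L] [Module F L] [SuperModule F L] [LieSuperAlgebra F L]
    [AddCommGroup T] [Module F T] [SuperModule F T] [LieSuperAlgebra F T] where
  pair : L →ₗ[F] L →ₗ[F] T
  pair_grade : ∀ (a b : ZMod 2) (x y : L), x ∈ gr F L a → y ∈ gr F L b →
    pair x y ∈ gr F T (a + b)
  rel1 : ∀ (a b : ZMod 2) (x x' y : L), x ∈ gr F L a → x' ∈ gr F L b →
    pair (br F L x x') y = pair x (br F L x' y) - sgn F a b • pair x' (br F L x y)
  rel2 : ∀ (a b c : ZMod 2) (x y y' : L), x ∈ gr F L a → y ∈ gr F L b → y' ∈ gr F L c →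
    pair x (br F L y y') = sgn F c (a + b) • pair (br F L y' x) y
      - sgn F a b • pair (br F L y x) y'
  rel3 : ∀ (a b : ZMod 2) (x y x' y' : L), x ∈ gr F L a → y ∈ gr F L b →
    br F T (pair x y) (pair x' y') = - sgn F a b • pair (br F L y x) (br F L x' y')

/-- `T`, together with the pairing `p`, is (a realization of) the non-abelian tensor
square `L ⊗ L`. -/
def IsTensorSquare (F : Type u) (L : Type v) (T : Type w) [Field F]
    [AddCommGroup L] [Module F L] [SuperModule F L] [LieSuperAlgebra F L]
    [AddCommGroup T] [Module F T] [SuperModule F T] [LieSuperAlgebra F T]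
    (p : TensorSqPairing F L T) : Prop :=
  ∀ (T' : Type (max u v w)) [AddCommGroup T'] [Module F T'] [SuperModule F T']
    [LieSuperAlgebra F T'] (q : TensorSqPairing F L T'),
    ∃! h : LieSuperHom F T T', ∀ x y : L, h.toLinearMap (p.pair x y) = q.pair x y

/-- The submodule `L □ L` of a realization `T` of `L ⊗ L`, generated by the elements
`x ⊗ x' + (-1)^{|x||x'|} (x' ⊗ x)` (homogeneous `x, x'`) and `x₀ ⊗ x₀` (`x₀` even). -/
def squareBox (F : Type u) (L : Type v) (T : Type w) [Field F]
    [AddCommGroup L] [Module F L] [SuperModule F L] [LieSuperAlgebra F L]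
    [AddCommGroup T] [Module F T] [SuperModule F T] [LieSuperAlgebra F T]
    (p : TensorSqPairing F L T) : Submodule F T :=
  Submodule.span F
    ({t | ∃ (a b : ZMod 2) (x y : L), x ∈ gr F L a ∧ y ∈ gr F L b ∧
        t = p.pair x y + sgn F a b • p.pair y x} ∪
      {t | ∃ x ∈ gr F L 0, t = p.pair x x})

/-- Data of a "universal quadratic functor" target: maps satisfying the defining
relations of `Γ(V)`. -/
structure GammaData (F : Type u) (V : Type v) (W : Type w) [Field F]
    [AddCommGroup V] [Module F V] [SuperModule F V] [AddCommGroup W] [Module F W] where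
  gam : V → W
  bil : V →ₗ[F] V →ₗ[F] W
  gam_smul : ∀ (c : F) (v : V), v ∈ gr F V 0 → gam (c • v) = (c * c) • gam v
  gam_add : ∀ v w' : V, v ∈ gr F V 0 → w' ∈ gr F V 0 →
    gam (v + w') - gam v - gam w' = bil v w'
  bil_symm : ∀ (a b : ZMod 2) (v w' : V), v ∈ gr F V a → w' ∈ gr F V b →
    bil v w' = sgn F a b • bil w' v
  bil_alt : ∀ v : V, v ∈ gr F V 1 → bil v v = 0

/-- `W`, with data `d`, is (a realization of) the universal quadratic functor `Γ(V)`. -/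
def IsGamma (F : Type u) (V : Type v) (W : Type w) [Field F]
    [AddCommGroup V] [Module F V] [SuperModule F V] [AddCommGroup W] [Module F W]
    (d : GammaData F V W) : Prop :=
  ∀ (W' : Type (max u v w)) [AddCommGroup W'] [Module F W'] (d' : GammaData F V W'),
    ∃! h : W →ₗ[F] W',
      (∀ v ∈ gr F V 0, h (d.gam v) = d'.gam v) ∧ (∀ v w' : V, h (d.bil v w') = d'.bil v w')

/-- `Fr` is a free Lie superalgebra on the graded set `(X, deg)` with inclusion `ι`. -/
def IsFreeLSA (F : Type u) (X : Type v) (deg : X → ZMod 2) (Fr : Type w) [Field F]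
    [AddCommGroup Fr] [Module F Fr] [SuperModule F Fr] [LieSuperAlgebra F Fr]
    (ι : X → Fr) : Prop :=
  (∀ x : X, ι x ∈ gr F Fr (deg x)) ∧
  ∀ (K : Type (max u v w)) [AddCommGroup K] [Module F K] [SuperModule F K]
    [LieSuperAlgebra F K] (f : X → K), (∀ x : X, f x ∈ gr F K (deg x)) →
    ∃! h : LieSuperHom F Fr K, ∀ x : X, h.toLinearMap (ι x) = f x

/-- Dimension of the degree-`a` part of the Schur multiplier `(R ∩ [Fr,Fr])/[Fr,R]`
attached to a free presentation with kernel `R`. -/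
noncomputable def schurDim (F : Type u) (Fr : Type v) [Field F] [AddCommGroup Fr]
    [Module F Fr] [SuperModule F Fr] [LieSuperAlgebra F Fr]
    (R : Submodule F Fr) (a : ZMod 2) : ℕ :=
  finrank F ((R ⊓ derivedSub F Fr ⊓ gr F Fr a).map (bracketSub F Fr ⊤ R).mkQ)

/-- `L` is (isomorphic to) the Heisenberg Lie superalgebra `H(m, n)` with even center:
it admits a homogeneous basis `x₁,…,x_{2m}, y₁,…,y_n, z` with the defining brackets. -/
def IsHmn (F : Type u) (m n : ℕ) (L : Type v) [Field F]
    [AddCommGroup L] [Module F L] [SuperModule F L] [LieSuperAlgebra F L] : Prop :=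
  ∃ (xv : Fin (2 * m) → L) (yv : Fin n → L) (zv : L)
    (B : Basis ((Fin (2 * m)) ⊕ (Fin n) ⊕ Unit) F L),
    (∀ i, B (Sum.inl i) = xv i) ∧ (∀ j, B (Sum.inr (Sum.inl j)) = yv j) ∧
    B (Sum.inr (Sum.inr ())) = zv ∧
    (∀ i, xv i ∈ gr F L 0) ∧ (∀ j, yv j ∈ gr F L 1) ∧ zv ∈ gr F L 0 ∧
    (∀ i j : Fin (2 * m), br F L (xv i) (xv j) =
      if (j : ℕ) = (i : ℕ) + m then zv else if (i : ℕ) = (j : ℕ) + m then -zv else 0) ∧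
    (∀ (i : Fin (2 * m)) (j : Fin n), br F L (xv i) (yv j) = 0) ∧
    (∀ (j : Fin n) (i : Fin (2 * m)), br F L (yv j) (xv i) = 0) ∧
    (∀ j k : Fin n, br F L (yv j) (yv k) = if j = k then zv else 0) ∧
    (∀ i, br F L (xv i) zv = 0) ∧ (∀ i, br F L zv (xv i) = 0) ∧
    (∀ j, br F L (yv j) zv = 0) ∧ (∀ j, br F L zv (yv j) = 0) ∧
    br F L zv zv = 0

/-- `L` is (isomorphic to) the Heisenberg Lie superalgebra `H_m` with odd center. -/
def IsHmOdd (F : Type u) (m : ℕ) (L : Type v) [Field F]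
    [AddCommGroup L] [Module F L] [SuperModule F L] [LieSuperAlgebra F L] : Prop :=
  ∃ (xv yv : Fin m → L) (zv : L) (B : Basis ((Fin m) ⊕ (Fin m) ⊕ Unit) F L),
    (∀ i, B (Sum.inl i) = xv i) ∧ (∀ j, B (Sum.inr (Sum.inl j)) = yv j) ∧
    B (Sum.inr (Sum.inr ())) = zv ∧
    (∀ i, xv i ∈ gr F L 0) ∧ (∀ j, yv j ∈ gr F L 1) ∧ zv ∈ gr F L 1 ∧
    (∀ i j, br F L (xv i) (xv j) = 0) ∧
    (∀ i j, br F L (xv i) (yv j) = if i = j then zv else 0) ∧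
    (∀ i j, br F L (yv i) (xv j) = if i = j then -zv else 0) ∧
    (∀ i j, br F L (yv i) (yv j) = 0) ∧
    (∀ i, br F L (xv i) zv = 0) ∧ (∀ i, br F L zv (xv i) = 0) ∧
    (∀ j, br F L (yv j) zv = 0) ∧ (∀ j, br F L zv (yv j) = 0) ∧
    br F L zv zv = 0

/-- `A` is (isomorphic to) the abelian Lie superalgebra `A(a | b)`. -/
def IsAbelianOfDim (F : Type u) (a b : ℕ) (A : Type v) [Field F]
    [AddCommGroup A] [Module F A] [SuperModule F A] [LieSuperAlgebra F A] : Prop :=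
  IsAbelianLSA F A ∧ finrank F (gr F A 0) = a ∧ finrank F (gr F A 1) = b

/-- Heisenberg Lie superalgebra with even center: `Z(L) = L²` is one-dimensional,
spanned by a nonzero even element. -/
def IsHeisenbergEven (F : Type u) (L : Type v) [Field F]
    [AddCommGroup L] [Module F L] [SuperModule F L] [LieSuperAlgebra F L] : Prop :=
  centerSub F L = derivedSub F L ∧
  ∃ zc : L, zc ≠ 0 ∧ zc ∈ gr F L 0 ∧ centerSub F L = Submodule.span F {zc}

/-- Heisenberg Lie superalgebra with odd center. -/
def IsHeisenbergOdd (F : Type u) (L : Type v) [Field F]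
    [AddCommGroup L] [Module F L] [SuperModule F L] [LieSuperAlgebra F L] : Prop :=
  centerSub F L = derivedSub F L ∧
  ∃ zc : L, zc ≠ 0 ∧ zc ∈ gr F L 1 ∧ centerSub F L = Submodule.span F {zc}

/-- `P ≅ L ⊕ M` as Lie superalgebras (internal direct sum of two commuting copies). -/
def IsDirectSumOf (F : Type u) (P : Type v) (L : Type w) (M : Type x) [Field F]
    [AddCommGroup P] [Module F P] [SuperModule F P] [LieSuperAlgebra F P]
    [AddCommGroup L] [Module F L] [SuperModule F L] [LieSuperAlgebra F L]
    [AddCommGroup M] [Module F M] [SuperModule F M] [LieSuperAlgebra F M] : Prop :=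
  ∃ (f : LieSuperHom F L P) (g : LieSuperHom F M P),
    Function.Bijective (fun q : L × M => f.toLinearMap q.1 + g.toLinearMap q.2) ∧
    (∀ (x : L) (y : M), br F P (f.toLinearMap x) (g.toLinearMap y) = 0) ∧
    (∀ (y : M) (x : L), br F P (g.toLinearMap y) (f.toLinearMap x) = 0)

/-- `S ≅ A ⊕ B ⊕ C ⊕ D` as Lie superalgebras. -/
def IsDirectSumOf4 (F : Type u) (S : Type v) (A : Type w) (B : Type x) (C : Type y)
    (D : Type z) [Field F]
    [AddCommGroup S] [Module F S] [SuperModule F S] [LieSuperAlgebra F S]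
    [AddCommGroup A] [Module F A] [SuperModule F A] [LieSuperAlgebra F A]
    [AddCommGroup B] [Module F B] [SuperModule F B] [LieSuperAlgebra F B]
    [AddCommGroup C] [Module F C] [SuperModule F C] [LieSuperAlgebra F C]
    [AddCommGroup D] [Module F D] [SuperModule F D] [LieSuperAlgebra F D] : Prop :=
  ∃ (f : LieSuperHom F A S) (g : LieSuperHom F B S) (h : LieSuperHom F C S)
    (k : LieSuperHom F D S),
    Function.Bijective (fun q : A × B × C × D =>
      f.toLinearMap q.1 + g.toLinearMap q.2.1 + h.toLinearMap q.2.2.1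
        + k.toLinearMap q.2.2.2) ∧
    (∀ u v', br F S (f.toLinearMap u) (g.toLinearMap v') = 0) ∧
    (∀ u v', br F S (f.toLinearMap u) (h.toLinearMap v') = 0) ∧
    (∀ u v', br F S (f.toLinearMap u) (k.toLinearMap v') = 0) ∧
    (∀ u v', br F S (g.toLinearMap u) (h.toLinearMap v') = 0) ∧
    (∀ u v', br F S (g.toLinearMap u) (k.toLinearMap v') = 0) ∧
    (∀ u v', br F S (h.toLinearMap u) (k.toLinearMap v') = 0)

/-- `L ≅ H(m, n) ⊕ A(a | b)`: an internal decomposition into a Heisenberg part with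
even center, spanned by homogeneous elements with the defining brackets, and a central
abelian graded complement of dimension `(a | b)`. -/
def DecompHeisenbergAbelian (F : Type u) (L : Type v) [Field F]
    [AddCommGroup L] [Module F L] [SuperModule F L] [LieSuperAlgebra F L]
    (m n a b : ℕ) : Prop :=
  ∃ (xv : Fin (2 * m) → L) (yv : Fin n → L) (zv : L) (A : Submodule F L),
    (∀ i, xv i ∈ gr F L 0) ∧ (∀ j, yv j ∈ gr F L 1) ∧ zv ∈ gr F L 0 ∧
    IsGradedSub F A ∧
    finrank F (A ⊓ gr F L 0 : Submodule F L) = a ∧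
    finrank F (A ⊓ gr F L 1 : Submodule F L) = b ∧
    (∀ u ∈ A, ∀ v : L, br F L u v = 0 ∧ br F L v u = 0) ∧
    LinearIndependent F (Sum.elim xv (Sum.elim yv (fun _ : Unit => zv))) ∧
    Disjoint (Submodule.span F (Set.range (Sum.elim xv (Sum.elim yv (fun _ : Unit => zv))))) A ∧
    Submodule.span F (Set.range (Sum.elim xv (Sum.elim yv (fun _ : Unit => zv)))) ⊔ A = ⊤ ∧
    (∀ i j : Fin (2 * m), br F L (xv i) (xv j) =
      if (j : ℕ) = (i : ℕ) + m then zv else if (i : ℕ) = (j : ℕ) + m then -zv else 0) ∧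
    (∀ (i : Fin (2 * m)) (j : Fin n), br F L (xv i) (yv j) = 0) ∧
    (∀ (j : Fin n) (i : Fin (2 * m)), br F L (yv j) (xv i) = 0) ∧
    (∀ j k : Fin n, br F L (yv j) (yv k) = if j = k then zv else 0) ∧
    (∀ i, br F L (xv i) zv = 0) ∧ (∀ i, br F L zv (xv i) = 0) ∧
    (∀ j, br F L (yv j) zv = 0) ∧ (∀ j, br F L zv (yv j) = 0) ∧
    br F L zv zv = 0

/-- The submodule of a realization of `I ⊗ J` (for graded ideals `I, J` of `M`)
generated by `x ⊗ y + (-1)^(|x||y|) y ⊗ x` and `x₀ ⊗ x₀` for `x, y, x₀ ∈ I ∩ J`,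
`x₀` even. -/
def pairBox (F : Type u) (I : Type v) (J : Type w) (TIJ : Type x) (M : Type y) [Field F]
    [AddCommGroup I] [Module F I] [SuperModule F I] [LieSuperAlgebra F I]
    [AddCommGroup J] [Module F J] [SuperModule F J] [LieSuperAlgebra F J]
    [AddCommGroup TIJ] [Module F TIJ] [SuperModule F TIJ] [LieSuperAlgebra F TIJ]
    [AddCommGroup M] [Module F M] [SuperModule F M] [LieSuperAlgebra F M]
    (ι : LieSuperHom F I M) (κ : LieSuperHom F J M)
    (α : LieSuperAction F I J) (β : LieSuperAction F J I)
    (p : SuperPairing F I J TIJ α β) : Submodule F TIJ :=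
  Submodule.span F
    ({t | ∃ (a b : ZMod 2) (i i' : I) (j j' : J),
        ι.toLinearMap i = κ.toLinearMap j ∧ ι.toLinearMap i' = κ.toLinearMap j' ∧
        ι.toLinearMap i ∈ gr F M a ∧ ι.toLinearMap i' ∈ gr F M b ∧
        t = p.pair i j' + sgn F a b • p.pair i' j} ∪
      {t | ∃ (i : I) (j : J), ι.toLinearMap i = κ.toLinearMap j ∧
        ι.toLinearMap i ∈ gr F M 0 ∧ t = p.pair i j})

section Aux

structure PrePair (F : Type u) (M : Type v) (N : Type w) (T : Type x) [Field F]
    [AddCommGroup M] [Module F M] [SuperModule F M] [LieSuperAlgebra F M]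
    [AddCommGroup N] [Module F N] [SuperModule F N] [LieSuperAlgebra F N]
    [AddCommGroup T] [Module F T] [SuperModule F T] [LieSuperAlgebra F T]
    (α : M →ₗ[F] N →ₗ[F] N) (β : N →ₗ[F] M →ₗ[F] M) where
  pair : M →ₗ[F] N →ₗ[F] T
  pair_grade : ∀ (a b : ZMod 2) (m : M) (n : N), m ∈ gr F M a → n ∈ gr F N b →
    pair m n ∈ gr F T (a + b)
  rel1 : ∀ (a b : ZMod 2) (m m' : M) (n : N), m ∈ gr F M a → m' ∈ gr F M b →
    pair (br F M m m') n = pair m (α m' n) - sgn F a b • pair m' (α m n)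
  rel2 : ∀ (a b c : ZMod 2) (m : M) (n n' : N), m ∈ gr F M a → n ∈ gr F N b → n' ∈ gr F N c →
    pair m (br F N n n') = sgn F c (a + b) • pair (β n' m) n - sgn F a b • pair (β n m) n'
  rel3 : ∀ (a b : ZMod 2) (m : M) (n : N) (m' : M) (n' : N), m ∈ gr F M a → n ∈ gr F N b →
    br F T (pair m n) (pair m' n') = - sgn F a b • pair (β n m) (α m' n')

def IsUnivPair (F : Type u) (M : Type v) (N : Type w) (T : Type x) [Field F]
    [AddCommGroup M] [Module F M] [SuperModule F M] [LieSuperAlgebra F M]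
    [AddCommGroup N] [Module F N] [SuperModule F N] [LieSuperAlgebra F N]
    [AddCommGroup T] [Module F T] [SuperModule F T] [LieSuperAlgebra F T]
    (α : M →ₗ[F] N →ₗ[F] N) (β : N →ₗ[F] M →ₗ[F] M)
    (p : PrePair F M N T α β) : Prop :=
  ∀ (T' : Type (max u v w x)) [AddCommGroup T'] [Module F T'] [SuperModule F T']
    [LieSuperAlgebra F T'] (q : PrePair F M N T' α β),
    ∃! h : LieSuperHom F T T', ∀ (m : M) (n : N), h.toLinearMap (p.pair m n) = q.pair m n

variable {F : Type u} [Field F]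

theorem exists_hom {V : Type v} [AddCommGroup V] [Module F V] [SuperModule F V] (t : V) :
    ∃ t0 ∈ gr F V 0, ∃ t1 ∈ gr F V 1, t = t0 + t1 := by
  have h : t ∈ gr F V 0 ⊔ gr F V 1 := by
    rw [(SuperModule.isCompl_grade (F := F) (V := V)).sup_eq_top]; trivial
  obtain ⟨a, ha, b, hb, h⟩ := Submodule.mem_sup.1 h
  exact ⟨a, ha, b, hb, h.symm⟩

/-- grading pulled back along an injective map with graded range -/
def comapSuper {V : Type v} {T : Type w} [AddCommGroup V] [Module F V]
    [AddCommGroup T] [Module F T] [SuperModule F T] (i : V →ₗ[F] T) (hi : Function.Injective i)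
    (hg : IsGradedSub F (LinearMap.range i)) : SuperModule F V where
  grade a := (gr F T a).comap i
  isCompl_grade := by
    have hc := SuperModule.isCompl_grade (F := F) (V := T)
    constructor
    · rw [Submodule.disjoint_def]
      intro t h0 h1
      have := (Submodule.disjoint_def.1 hc.disjoint) (i t) h0 h1
      exact hi (by simpa using this)
    · rw [codisjoint_iff, eq_top_iff]
      intro t _
      have := hg (LinearMap.mem_range_self i t)
      obtain ⟨a, ⟨⟨a', rfl⟩, ha⟩, b, ⟨⟨b', rfl⟩, hb⟩, h⟩ := Submodule.mem_sup.1 this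
      refine Submodule.mem_sup.2 ⟨a', ha, b', hb, hi (by simpa using h)⟩

theorem mem_comapSuper {V : Type v} {T : Type w} [AddCommGroup V] [Module F V]
    [AddCommGroup T] [Module F T] [SuperModule F T] (i : V →ₗ[F] T) (hi : Function.Injective i)
    (hg : IsGradedSub F (LinearMap.range i)) (a : ZMod 2) (t : V) :
    t ∈ @gr F V _ _ _ (comapSuper i hi hg) a ↔ i t ∈ gr F T a := Iff.rfl

theorem exists_comap {V : Type v} {T : Type w} [AddCommGroup V] [Module F V]
    [AddCommGroup T] [Module F T] [SuperModule F T] [LieSuperAlgebra F T]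
    (i : V →ₗ[F] T) (hi : Function.Injective i)
    (hg : IsGradedSub F (LinearMap.range i))
    (hb : ∀ s t, br F T (i s) (i t) ∈ LinearMap.range i) :
    ∃ (_ : SuperModule F V) (_ : LieSuperAlgebra F V) (j : LieSuperHom F V T),
      j.toLinearMap = i ∧ ∀ a t, t ∈ gr F V a ↔ i t ∈ gr F T a := by
  choose c hc using hb
  letI s : SuperModule F V := comapSuper i hi hg
  have hm : ∀ a t, t ∈ gr F V a ↔ i t ∈ gr F T a := mem_comapSuper i hi hg
  let B : V →ₗ[F] V →ₗ[F] V := LinearMap.mk₂ F c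
    (by intros; apply hi; simp [hc]) (by intros; apply hi; simp [hc])
    (by intros; apply hi; simp [hc]) (by intros; apply hi; simp [hc])
  have hB : ∀ s t, i (B s t) = br F T (i s) (i t) := fun s t => hc s t
  letI l : LieSuperAlgebra F V :=
    { bracket := B
      bracket_grade := by
        intro a b s t hs ht
        rw [hm, hB]
        exact LieSuperAlgebra.bracket_grade a b _ _ hs ht
      skew := by
        intro a b s t hs ht
        apply hi
        rw [map_smul, hB, hB]
        exact LieSuperAlgebra.skew a b _ _ hs ht
      jacobi := by
        intro a b c s t r hs ht hr
        apply hi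
        simp only [map_add, map_smul, hB, map_zero]
        exact LieSuperAlgebra.jacobi a b c _ _ _ hs ht hr }
  exact ⟨s, l, { toLinearMap := i, map_grade := fun a t h => h, map_bracket := hB }, rfl, hm⟩

section P
variable {M : Type v} {N : Type w} {T : Type x}
    [AddCommGroup M] [Module F M] [SuperModule F M] [LieSuperAlgebra F M]
    [AddCommGroup N] [Module F N] [SuperModule F N] [LieSuperAlgebra F N]
    [AddCommGroup T] [Module F T] [SuperModule F T] [LieSuperAlgebra F T]
    {α : M →ₗ[F] N →ₗ[F] N} {β : N →ₗ[F] M →ₗ[F] M}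

theorem PrePair.span_eq_range (p : PrePair F M N T α β) :
    LinearMap.range (TensorProduct.lift p.pair) =
      Submodule.span F {t | ∃ m n, p.pair m n = t} := by
  rw [← Submodule.map_top, ← TensorProduct.span_tmul_eq_top, Submodule.map_span]
  congr 1
  ext t
  constructor
  · rintro ⟨_, ⟨m, n, rfl⟩, rfl⟩
    exact ⟨m, n, by simp⟩
  · rintro ⟨m, n, rfl⟩
    exact ⟨_, ⟨m, n, rfl⟩, by simp⟩

theorem PrePair.graded_range (p : PrePair F M N T α β) :
    IsGradedSub F (LinearMap.range (TensorProduct.lift p.pair)) := by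
  intro t ht
  set R := LinearMap.range (TensorProduct.lift p.pair) with hR
  have hmem : ∀ m n, p.pair m n ∈ R := fun m n => ⟨m ⊗ₜ n, by simp⟩
  have key : ∀ a b m n, m ∈ gr F M a → n ∈ gr F N b →
      p.pair m n ∈ (R ⊓ gr F T 0) ⊔ (R ⊓ gr F T 1) := by
    intro a b m n hm hn
    have h := p.pair_grade a b m n hm hn
    have h01 : ∀ d : ZMod 2, d = 0 ∨ d = 1 := by decide
    rcases h01 (a + b) with h' | h' <;> rw [h'] at h
    · exact Submodule.mem_sup_left ⟨hmem m n, h⟩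
    · exact Submodule.mem_sup_right ⟨hmem m n, h⟩
  rw [hR, p.span_eq_range] at ht
  refine Submodule.span_le.2 ?_ ht
  rintro _ ⟨m, n, rfl⟩
  obtain ⟨m0, hm0, m1, hm1, rfl⟩ := exists_hom (F := F) m
  obtain ⟨n0, hn0, n1, hn1, rfl⟩ := exists_hom (F := F) n
  simp only [map_add, LinearMap.add_apply, SetLike.mem_coe]
  exact add_mem (add_mem (key _ _ _ _ hm0 hn0) (key _ _ _ _ hm1 hn0))
    (add_mem (key _ _ _ _ hm0 hn1) (key _ _ _ _ hm1 hn1))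

theorem PrePair.br_range (p : PrePair F M N T α β) (s t : T)
    (hs : s ∈ LinearMap.range (TensorProduct.lift p.pair))
    (ht : t ∈ LinearMap.range (TensorProduct.lift p.pair)) :
    br F T s t ∈ LinearMap.range (TensorProduct.lift p.pair) := by
  set R := LinearMap.range (TensorProduct.lift p.pair) with hR
  have hmem : ∀ m n, p.pair m n ∈ R := fun m n => ⟨m ⊗ₜ n, by simp⟩
  have key : ∀ a b m n m' n', m ∈ gr F M a → n ∈ gr F N b →
      br F T (p.pair m n) (p.pair m' n') ∈ R := by
    intro a b m n m' n' hm hn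
    rw [p.rel3 a b m n m' n' hm hn]
    exact R.smul_mem _ (hmem _ _)
  rw [hR, p.span_eq_range] at hs ht
  have h1 : ∀ m n, br F T (p.pair m n) t ∈ R := by
    intro m n
    refine (Submodule.span_le (p := R.comap (br F T (p.pair m n)))).2 ?_ ht
    rintro _ ⟨m', n', rfl⟩
    obtain ⟨m0, hm0, m1, hm1, rfl⟩ := exists_hom (F := F) m
    obtain ⟨n0, hn0, n1, hn1, rfl⟩ := exists_hom (F := F) n
    simp only [map_add, LinearMap.add_apply, SetLike.mem_coe, Submodule.mem_comap]
    exact add_mem (add_mem (key _ _ _ _ _ _ hm0 hn0) (key _ _ _ _ _ _ hm1 hn0))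
      (add_mem (key _ _ _ _ _ _ hm0 hn1) (key _ _ _ _ _ _ hm1 hn1))
  refine (Submodule.span_le (p := R.comap ((br F T).flip t))).2 ?_ hs
  rintro _ ⟨m, n, rfl⟩
  exact h1 m n

/-- lift a pairing through an injective map onto its span -/
theorem PrePair.exists_lift (p : PrePair F M N T α β) {V : Type y} [AddCommGroup V] [Module F V]
    (i : V →ₗ[F] T) (hi : Function.Injective i)
    (hr : LinearMap.range i = LinearMap.range (TensorProduct.lift p.pair)) :
    ∃ (_ : SuperModule F V) (_ : LieSuperAlgebra F V) (j : LieSuperHom F V T)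
      (q : PrePair F M N V α β),
      j.toLinearMap = i ∧ ∀ m n, i (q.pair m n) = p.pair m n := by
  obtain ⟨s, l, j, hj, hm⟩ := exists_comap i hi (hr ▸ p.graded_range)
    (fun s t => by
      rw [hr]
      exact p.br_range _ _ (hr ▸ LinearMap.mem_range_self i s)
        (hr ▸ LinearMap.mem_range_self i t))
  have hex : ∀ m n, ∃ t, i t = p.pair m n := fun m n => by
    have : p.pair m n ∈ LinearMap.range i := hr ▸ ⟨m ⊗ₜ n, by simp⟩
    exact this
  choose c hc using hex
  have hb : ∀ s t, i (br F V s t) = br F T (i s) (i t) := by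
    intro s t
    have := j.map_bracket s t
    rwa [hj] at this
  refine ⟨s, l, j,
    { pair := LinearMap.mk₂ F c
        (by intros; apply hi; simp [hc]) (by intros; apply hi; simp [hc])
        (by intros; apply hi; simp [hc]) (by intros; apply hi; simp [hc])
      pair_grade := ?_
      rel1 := ?_
      rel2 := ?_
      rel3 := ?_ }, hj, hc⟩
  · intro a b m n h h'
    rw [hm, LinearMap.mk₂_apply, hc]
    exact p.pair_grade a b m n h h'
  · intro a b m m' n h h'
    apply hi
    simp only [LinearMap.mk₂_apply, map_sub, map_smul, hc]
    exact p.rel1 a b m m' n h h'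
  · intro a b c m n n' h h' h''
    apply hi
    simp only [LinearMap.mk₂_apply, map_sub, map_smul, hc]
    exact p.rel2 a b c m n n' h h' h''
  · intro a b m n m' n' h h'
    apply hi
    simp only [LinearMap.mk₂_apply, map_smul, hc, hb]
    exact p.rel3 a b m n m' n' h h'

def LieSuperHom.comp' {A : Type*} {B : Type*} {C : Type*}
    [AddCommGroup A] [Module F A] [SuperModule F A] [LieSuperAlgebra F A]
    [AddCommGroup B] [Module F B] [SuperModule F B] [LieSuperAlgebra F B]
    [AddCommGroup C] [Module F C] [SuperModule F C] [LieSuperAlgebra F C]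
    (g : LieSuperHom F B C) (f : LieSuperHom F A B) : LieSuperHom F A C where
  toLinearMap := g.toLinearMap ∘ₗ f.toLinearMap
  map_grade a t h := g.map_grade a _ (f.map_grade a t h)
  map_bracket s t := by simp [f.map_bracket, g.map_bracket]

theorem IsUnivPair.exists_hom {p : PrePair F M N T α β} (hp : IsUnivPair F M N T α β p)
    {T' : Type y} [AddCommGroup T'] [Module F T'] [SuperModule F T'] [LieSuperAlgebra F T']
    (q : PrePair F M N T' α β) :
    ∃ h : LieSuperHom F T T', ∀ m n, h.toLinearMap (p.pair m n) = q.pair m n := by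
  let K := (M ⊗[F] N) ⧸ LinearMap.ker (TensorProduct.lift q.pair)
  let V : Type (max u v w x) := ULift.{max u x} K
  let i : V →ₗ[F] T' := ((LinearMap.ker (TensorProduct.lift q.pair)).liftQ
    (TensorProduct.lift q.pair) le_rfl) ∘ₗ (ULift.moduleEquiv (R := F) (M := K)).toLinearMap
  have hi : Function.Injective i := by
    have h1 : Function.Injective ((LinearMap.ker (TensorProduct.lift q.pair)).liftQ
      (TensorProduct.lift q.pair) le_rfl) := by
      rw [← LinearMap.ker_eq_bot]
      exact Submodule.ker_liftQ_eq_bot _ _ _ le_rfl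
    exact h1.comp (ULift.moduleEquiv (R := F) (M := K)).injective
  have hr : LinearMap.range i = LinearMap.range (TensorProduct.lift q.pair) := by
    rw [LinearMap.range_comp, LinearEquiv.range, Submodule.map_top, Submodule.range_liftQ]
  obtain ⟨s, l, j, q', hj, hq'⟩ := q.exists_lift i hi hr
  obtain ⟨h, hh, -⟩ := hp V q'
  refine ⟨j.comp' h, fun m n => ?_⟩
  show j.toLinearMap (h.toLinearMap _) = _
  rw [hh, hj, hq']

theorem IsUnivPair.range_eq_top {p : PrePair F M N T α β} (hp : IsUnivPair F M N T α β p) :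
    LinearMap.range (TensorProduct.lift p.pair) = ⊤ := by
  set R := LinearMap.range (TensorProduct.lift p.pair) with hR
  obtain ⟨s, l, j, q, hj, hq⟩ := p.exists_lift R.subtype R.injective_subtype
    (by rw [Submodule.range_subtype])
  obtain ⟨h, hh⟩ := hp.exists_hom q
  let V : Type (max u v w x) := ULift.{max u v w} T
  let e : V ≃ₗ[F] T := ULift.moduleEquiv
  have htop : LinearMap.range e.toLinearMap = ⊤ := LinearEquiv.range e
  obtain ⟨s', l', j', hj', hm'⟩ := exists_comap e.toLinearMap e.injective
    (by
      rw [htop]; intro t _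
      rw [top_inf_eq, top_inf_eq, (SuperModule.isCompl_grade (F := F) (V := T)).sup_eq_top]
      trivial)
    (fun s t => by rw [htop]; trivial)
  have hb : ∀ s t, e (br F V s t) = br F T (e s) (e t) := by
    intro s t
    have := j'.map_bracket s t
    rwa [hj'] at this
  let up : LieSuperHom F T V :=
    { toLinearMap := e.symm.toLinearMap
      map_grade := by
        intro a t ht
        rw [hm']
        simpa using ht
      map_bracket := by
        intro s t
        apply e.injective
        rw [hb]
        simp }
  let pu : PrePair F M N V α β :=
    { pair := p.pair.compr₂ e.symm.toLinearMap
      pair_grade := fun a b m n hm hn => up.map_grade _ _ (p.pair_grade a b m n hm hn)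
      rel1 := by
        intro a b m m' n hm hn
        simp [p.rel1 a b m m' n hm hn]
      rel2 := by
        intro a b c m n n' hm hn hn'
        simp [p.rel2 a b c m n n' hm hn hn']
      rel3 := by
        intro a b m n m' n' hm hn
        have := up.map_bracket (p.pair m n) (p.pair m' n')
        rw [p.rel3 a b m n m' n' hm hn, map_smul] at this
        exact this.symm }
  obtain ⟨g, -, hg⟩ := hp V pu
  have h1 := hg up (fun m n => rfl)
  have h2 := hg (up.comp' (j.comp' h)) (fun m n => by
    show e.symm (j.toLinearMap (h.toLinearMap _)) = e.symm _
    rw [hh, hj, hq])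
  rw [eq_top_iff]
  intro t _
  have h3 : e.symm t = e.symm (j.toLinearMap (h.toLinearMap t)) := by
    have : up.toLinearMap t = (up.comp' (j.comp' h)).toLinearMap t := by rw [h2, h1]
    exact this
  rw [e.symm.injective h3, hj]
  exact (h.toLinearMap t).2

theorem IsUnivPair.ext {p : PrePair F M N T α β} (hp : IsUnivPair F M N T α β p)
    {W : Type y} [AddCommGroup W] [Module F W] (f g : T →ₗ[F] W)
    (h : ∀ m n, f (p.pair m n) = g (p.pair m n)) (t : T) : f t = g t := by
  have ht : t ∈ LinearMap.range (TensorProduct.lift p.pair) := by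
    rw [hp.range_eq_top]; trivial
  obtain ⟨k, rfl⟩ := ht
  have : f ∘ₗ (TensorProduct.lift p.pair) = g ∘ₗ (TensorProduct.lift p.pair) :=
    TensorProduct.ext' (by intro m n; simpa using h m n)
  exact LinearMap.congr_fun this k

theorem bilin_hom_ext {W : Type y} [AddCommGroup W] [Module F W] (B : M →ₗ[F] N →ₗ[F] W)
    (h : ∀ a b m n, m ∈ gr F M a → n ∈ gr F N b → B m n = 0) (m : M) (n : N) : B m n = 0 := by
  obtain ⟨m0, hm0, m1, hm1, rfl⟩ := _root_.exists_hom (F := F) m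
  obtain ⟨n0, hn0, n1, hn1, rfl⟩ := _root_.exists_hom (F := F) n
  simp [h _ _ _ _ hm0 hn0, h _ _ _ _ hm0 hn1, h _ _ _ _ hm1 hn0, h _ _ _ _ hm1 hn1]

/-- pairing into the tensor square of the big algebra -/
def pairOfHoms {P : Type*} {TP : Type*}
    [AddCommGroup P] [Module F P] [SuperModule F P] [LieSuperAlgebra F P]
    [AddCommGroup TP] [Module F TP] [SuperModule F TP] [LieSuperAlgebra F TP]
    (p : PrePair F P P TP (br F P) (br F P)) (f : LieSuperHom F M P) (g : LieSuperHom F N P)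
    (hα : ∀ m n, br F P (f.toLinearMap m) (g.toLinearMap n) = g.toLinearMap (α m n))
    (hβ : ∀ m n, br F P (g.toLinearMap n) (f.toLinearMap m) = f.toLinearMap (β n m)) :
    PrePair F M N TP α β where
  pair := p.pair.compl₁₂ f.toLinearMap g.toLinearMap
  pair_grade a b m n hm hn := p.pair_grade a b _ _ (f.map_grade _ _ hm) (g.map_grade _ _ hn)
  rel1 a b m m' n hm hm' := by
    have := p.rel1 a b _ _ (g.toLinearMap n) (f.map_grade _ _ hm) (f.map_grade _ _ hm')
    simpa only [LinearMap.compl₁₂_apply, f.map_bracket, hα] using this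
  rel2 a b c m n n' hm hn hn' := by
    have := p.rel2 a b c _ _ _ (f.map_grade _ _ hm) (g.map_grade _ _ hn) (g.map_grade _ _ hn')
    simpa only [LinearMap.compl₁₂_apply, g.map_bracket, hβ] using this
  rel3 a b m n m' n' hm hn := by
    have := p.rel3 a b _ _ (f.toLinearMap m') (g.toLinearMap n')
      (f.map_grade _ _ hm) (g.map_grade _ _ hn)
    simpa only [LinearMap.compl₁₂_apply, hα, hβ] using this

/-- pairing of the big algebra through projections -/
def pairOfProj {P : Type*} {S : Type*}
    [AddCommGroup P] [Module F P] [SuperModule F P] [LieSuperAlgebra F P]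
    [AddCommGroup S] [Module F S] [SuperModule F S] [LieSuperAlgebra F S]
    (p : PrePair F M N T α β) (k : LieSuperHom F T S)
    (f : LieSuperHom F P M) (g : LieSuperHom F P N)
    (hα : ∀ m x n, p.pair m (α (f.toLinearMap x) n) = p.pair m (br F N (g.toLinearMap x) n))
    (hβ : ∀ m x n, p.pair (β (g.toLinearMap x) m) n = p.pair (br F M (f.toLinearMap x) m) n) :
    PrePair F P P S (br F P) (br F P) where
  pair := (p.pair.compl₁₂ f.toLinearMap g.toLinearMap).compr₂ k.toLinearMap
  pair_grade a b m n hm hn := k.map_grade _ _ <|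
    p.pair_grade a b _ _ (f.map_grade _ _ hm) (g.map_grade _ _ hn)
  rel1 a b m m' n hm hm' := by
    have := p.rel1 a b _ _ (g.toLinearMap n) (f.map_grade _ _ hm) (f.map_grade _ _ hm')
    simp only [LinearMap.compl₁₂_apply, LinearMap.compr₂_apply, f.map_bracket, g.map_bracket,
      ← hα, this, map_sub, map_smul]
  rel2 a b c m n n' hm hn hn' := by
    have := p.rel2 a b c _ _ _ (f.map_grade _ _ hm) (g.map_grade _ _ hn) (g.map_grade _ _ hn')
    simp only [LinearMap.compl₁₂_apply, LinearMap.compr₂_apply, f.map_bracket, g.map_bracket,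
      ← hβ, this, map_sub, map_smul]
  rel3 a b m n m' n' hm hn := by
    have := p.rel3 a b _ _ (f.toLinearMap m') (g.toLinearMap n')
      (f.map_grade _ _ hm) (g.map_grade _ _ hn)
    simp only [LinearMap.compl₁₂_apply, LinearMap.compr₂_apply, f.map_bracket, g.map_bracket,
      ← hβ, ← hα, ← k.map_bracket, this, map_smul]

theorem PrePair.triv_left (p : PrePair F M N T 0 0) (m m' : M) (n : N) :
    p.pair (br F M m m') n = 0 := by
  refine bilin_hom_ext ((br F M).compr₂ (p.pair.flip n)) ?_ m m'
  intro a b m m' h h'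
  simpa using p.rel1 a b m m' n h h'

theorem PrePair.triv_right (p : PrePair F M N T 0 0) (m : M) (n n' : N) :
    p.pair m (br F N n n') = 0 := by
  refine bilin_hom_ext ((br F N).compr₂ (p.pair m)) ?_ n n'
  intro b c n n' h h'
  obtain ⟨m0, hm0, m1, hm1, rfl⟩ := _root_.exists_hom (F := F) m
  have h0 := p.rel2 _ b c m0 n n' hm0 h h'
  have h1 := p.rel2 _ b c m1 n n' hm1 h h'
  simp at h0 h1
  simp [h0, h1]

end P

/-- sum of commuting pairings -/
def PrePair.add' {M : Type v} {N : Type w} {T : Type x}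
    [AddCommGroup M] [Module F M] [SuperModule F M] [LieSuperAlgebra F M]
    [AddCommGroup N] [Module F N] [SuperModule F N] [LieSuperAlgebra F N]
    [AddCommGroup T] [Module F T] [SuperModule F T] [LieSuperAlgebra F T]
    {α : M →ₗ[F] N →ₗ[F] N} {β : N →ₗ[F] M →ₗ[F] M}
    (p q : PrePair F M N T α β)
    (h1 : ∀ m n m' n', br F T (p.pair m n) (q.pair m' n') = 0)
    (h2 : ∀ m n m' n', br F T (q.pair m n) (p.pair m' n') = 0) : PrePair F M N T α β where
  pair := p.pair + q.pair
  pair_grade a b m n hm hn := add_mem (p.pair_grade a b m n hm hn) (q.pair_grade a b m n hm hn)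
  rel1 a b m m' n hm hm' := by
    simp only [LinearMap.add_apply, p.rel1 a b m m' n hm hm', q.rel1 a b m m' n hm hm', smul_add]
    abel
  rel2 a b c m n n' hm hn hn' := by
    simp only [LinearMap.add_apply, p.rel2 a b c m n n' hm hn hn',
      q.rel2 a b c m n n' hm hn hn', smul_add]
    abel
  rel3 a b m n m' n' hm hn := by
    simp only [LinearMap.add_apply, map_add, p.rel3 a b m n m' n' hm hn, h1, h2,
      q.rel3 a b m n m' n' hm hn, smul_add, add_zero, zero_add]

theorem br_zero_symm {S : Type v} [AddCommGroup S] [Module F S] [SuperModule F S]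
    [LieSuperAlgebra F S] {A : Type w} {B : Type x}
    [AddCommGroup A] [Module F A] [SuperModule F A] [LieSuperAlgebra F A]
    [AddCommGroup B] [Module F B] [SuperModule F B] [LieSuperAlgebra F B]
    (f : LieSuperHom F A S) (g : LieSuperHom F B S)
    (h : ∀ a b, br F S (f.toLinearMap a) (g.toLinearMap b) = 0) (b : B) (a : A) :
    br F S (g.toLinearMap b) (f.toLinearMap a) = 0 := by
  refine bilin_hom_ext ((br F S).compl₁₂ g.toLinearMap f.toLinearMap) ?_ b a
  intro c d b a hb ha
  rw [LinearMap.compl₁₂_apply, LieSuperAlgebra.skew c d _ _ (g.map_grade _ _ hb)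
    (f.map_grade _ _ ha), h, smul_zero]

theorem exists_proj {P : Type v} [AddCommGroup P] [Module F P] [SuperModule F P]
    [LieSuperAlgebra F P] {L : Type w} {M : Type x}
    [AddCommGroup L] [Module F L] [SuperModule F L] [LieSuperAlgebra F L]
    [AddCommGroup M] [Module F M] [SuperModule F M] [LieSuperAlgebra F M]
    (f : LieSuperHom F L P) (g : LieSuperHom F M P)
    (hb : Function.Bijective (fun q : L × M => f.toLinearMap q.1 + g.toLinearMap q.2))
    (h1 : ∀ (x : L) (y : M), br F P (f.toLinearMap x) (g.toLinearMap y) = 0)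
    (h2 : ∀ (y : M) (x : L), br F P (g.toLinearMap y) (f.toLinearMap x) = 0) :
    ∃ (a : LieSuperHom F P L) (b : LieSuperHom F P M),
      (∀ x, f.toLinearMap (a.toLinearMap x) + g.toLinearMap (b.toLinearMap x) = x) ∧
      (∀ x, a.toLinearMap (f.toLinearMap x) = x) ∧ (∀ x, b.toLinearMap (g.toLinearMap x) = x) ∧
      (∀ x, a.toLinearMap (g.toLinearMap x) = 0) ∧ (∀ x, b.toLinearMap (f.toLinearMap x) = 0) := by
  let e : (L × M) ≃ₗ[F] P :=
    LinearEquiv.ofBijective (f.toLinearMap.coprod g.toLinearMap) (by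
      have h : ((f.toLinearMap.coprod g.toLinearMap : L × M →ₗ[F] P) : L × M → P) =
        fun q : L × M => f.toLinearMap q.1 + g.toLinearMap q.2 := by
          funext q; simp
      rw [h]; exact hb)
  have he : ∀ q, e q = f.toLinearMap q.1 + g.toLinearMap q.2 := fun q => rfl
  have hes : ∀ t, f.toLinearMap (e.symm t).1 + g.toLinearMap (e.symm t).2 = t := fun t => by
    rw [← he, e.apply_symm_apply]
  have hgr : ∀ (a : ZMod 2) t, t ∈ gr F P a → (e.symm t).1 ∈ gr F L a ∧ (e.symm t).2 ∈ gr F M a := by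
    intro a t ht
    obtain ⟨⟨l, m⟩, rfl⟩ := e.surjective t
    rw [e.symm_apply_apply]
    obtain ⟨l0, hl0, l1, hl1, rfl⟩ := exists_hom (F := F) l
    obtain ⟨m0, hm0, m1, hm1, rfl⟩ := exists_hom (F := F) m
    have e0 : e (l0, m0) ∈ gr F P 0 := add_mem (f.map_grade _ _ hl0) (g.map_grade _ _ hm0)
    have e1 : e (l1, m1) ∈ gr F P 1 := add_mem (f.map_grade _ _ hl1) (g.map_grade _ _ hm1)
    have hs : e (l0 + l1, m0 + m1) = e (l0, m0) + e (l1, m1) := by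
      rw [← map_add]; rfl
    rw [hs] at ht
    have hd := Submodule.disjoint_def.1 (SuperModule.isCompl_grade (F := F) (V := P)).disjoint
    have h01 : ∀ d : ZMod 2, d = 0 ∨ d = 1 := by decide
    rcases h01 a with rfl | rfl
    · have h' : e (l1, m1) ∈ gr F P 0 := by simpa using sub_mem ht e0
      have := hd _ h' e1
      rw [LinearEquiv.map_eq_zero_iff, Prod.mk_eq_zero] at this
      simp [this.1, this.2, hl0, hm0]
    · have h' : e (l0, m0) ∈ gr F P 1 := by simpa using sub_mem ht e1
      have := hd _ e0 h'
      rw [LinearEquiv.map_eq_zero_iff, Prod.mk_eq_zero] at this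
      simp [this.1, this.2, hl1, hm1]
  have hbr : ∀ s t, e.symm (br F P s t) =
      (br F L (e.symm s).1 (e.symm t).1, br F M (e.symm s).2 (e.symm t).2) := by
    intro s t
    rw [LinearEquiv.symm_apply_eq, he, f.map_bracket, g.map_bracket]
    conv_lhs => rw [← hes s, ← hes t]
    simp [h1, h2]
  have hf : ∀ l, e.symm (f.toLinearMap l) = (l, 0) := fun l => by
    rw [LinearEquiv.symm_apply_eq, he]; simp
  have hg : ∀ l, e.symm (g.toLinearMap l) = (0, l) := fun l => by
    rw [LinearEquiv.symm_apply_eq, he]; simp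
  refine ⟨{ toLinearMap := LinearMap.fst F L M ∘ₗ e.symm.toLinearMap
            map_grade := fun a t h => (hgr a t h).1
            map_bracket := fun s t => by simp [hbr] },
          { toLinearMap := LinearMap.snd F L M ∘ₗ e.symm.toLinearMap
            map_grade := fun a t h => (hgr a t h).2
            map_bracket := fun s t => by simp [hbr] }, hes, ?_, ?_, ?_, ?_⟩
  all_goals intro t; simp [hf, hg]

def TensorSqPairing.toPre {L : Type v} {T : Type w}
    [AddCommGroup L] [Module F L] [SuperModule F L] [LieSuperAlgebra F L]
    [AddCommGroup T] [Module F T] [SuperModule F T] [LieSuperAlgebra F T]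
    (p : TensorSqPairing F L T) : PrePair F L L T (br F L) (br F L) :=
  ⟨p.pair, p.pair_grade, p.rel1, p.rel2, p.rel3⟩

theorem IsTensorSquare.univ {L : Type v} {T : Type w}
    [AddCommGroup L] [Module F L] [SuperModule F L] [LieSuperAlgebra F L]
    [AddCommGroup T] [Module F T] [SuperModule F T] [LieSuperAlgebra F T]
    {p : TensorSqPairing F L T} (h : IsTensorSquare F L T p) :
    IsUnivPair F L L T (br F L) (br F L) p.toPre := by
  intro T' _ _ _ _ q
  exact h T' ⟨q.pair, q.pair_grade, q.rel1, q.rel2, q.rel3⟩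

def SuperPairing.toPre {M : Type v} {N : Type w} {T : Type x}
    [AddCommGroup M] [Module F M] [SuperModule F M] [LieSuperAlgebra F M]
    [AddCommGroup N] [Module F N] [SuperModule F N] [LieSuperAlgebra F N]
    [AddCommGroup T] [Module F T] [SuperModule F T] [LieSuperAlgebra F T]
    (p : SuperPairing F M N T (trivialAction F M N) (trivialAction F N M)) :
    PrePair F M N T 0 0 :=
  ⟨p.pair, p.pair_grade, p.rel1, p.rel2, p.rel3⟩

theorem IsTensorProductLSA.univ {M : Type v} {N : Type w} {T : Type x}
    [AddCommGroup M] [Module F M] [SuperModule F M] [LieSuperAlgebra F M]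
    [AddCommGroup N] [Module F N] [SuperModule F N] [LieSuperAlgebra F N]
    [AddCommGroup T] [Module F T] [SuperModule F T] [LieSuperAlgebra F T]
    {p : SuperPairing F M N T (trivialAction F M N) (trivialAction F N M)}
    (h : IsTensorProductLSA F M N T _ _ p) :
    IsUnivPair F M N T 0 0 p.toPre := by
  intro T' _ _ _ _ q
  exact h T' ⟨q.pair, q.pair_grade, q.rel1, q.rel2, q.rel3⟩

end Aux

theorem stmt_10 (F : Type*) [Field F] (hchar2 : ringChar F ≠ 2) (hchar3 : ringChar F ≠ 3)
    (L : Type*) [AddCommGroup L] [Module F L] [SuperModule F L] [LieSuperAlgebra F L]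
    (M : Type*) [AddCommGroup M] [Module F M] [SuperModule F M] [LieSuperAlgebra F M]
    (P : Type*) [AddCommGroup P] [Module F P] [SuperModule F P] [LieSuperAlgebra F P] (hP : IsDirectSumOf F P L M)
    (TP : Type*) [AddCommGroup TP] [Module F TP] [SuperModule F TP] [LieSuperAlgebra F TP]
    (pP : TensorSqPairing F P TP) (hTP : IsTensorSquare F P TP pP)
    (TLL : Type*) [AddCommGroup TLL] [Module F TLL] [SuperModule F TLL] [LieSuperAlgebra F TLL]
    (pLL : TensorSqPairing F L TLL) (hLL : IsTensorSquare F L TLL pLL)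
    (TLM : Type*) [AddCommGroup TLM] [Module F TLM] [SuperModule F TLM] [LieSuperAlgebra F TLM]
    (pLM : SuperPairing F L M TLM (trivialAction F L M) (trivialAction F M L))
    (hLM : IsTensorProductLSA F L M TLM (trivialAction F L M) (trivialAction F M L) pLM)
    (TML : Type*) [AddCommGroup TML] [Module F TML] [SuperModule F TML] [LieSuperAlgebra F TML]
    (pML : SuperPairing F M L TML (trivialAction F M L) (trivialAction F L M))
    (hML : IsTensorProductLSA F M L TML (trivialAction F M L) (trivialAction F L M) pML)
    (TMM : Type*) [AddCommGroup TMM] [Module F TMM] [SuperModule F TMM] [LieSuperAlgebra F TMM]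
    (pMM : TensorSqPairing F M TMM) (hMM : IsTensorSquare F M TMM pMM)
    (S : Type*) [AddCommGroup S] [Module F S] [SuperModule F S] [LieSuperAlgebra F S] (hS : IsDirectSumOf4 F S TLL TLM TML TMM) :
    LSAIsomorphic F TP S := by
  obtain ⟨f, g, hfg, hfg1, hfg2⟩ := hP
  obtain ⟨a, b, hab, haf, hbg, hag, hbf⟩ := exists_proj f g hfg hfg1 hfg2
  obtain ⟨i1, i2, i3, i4, hi, h12, h13, h14, h23, h24, h34⟩ := hS
  have uP := hTP.univ
  have u1 := hLL.univ
  have u2 := hLM.univ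
  have u3 := hML.univ
  have u4 := hMM.univ
  -- the forward map
  let q1 := pairOfProj pLL.toPre i1 a a (fun _ _ _ => rfl) (fun _ _ _ => rfl)
  let q2 := pairOfProj pLM.toPre i2 a b
    (fun m x n => by rw [PrePair.triv_right]; simp)
    (fun m x n => by rw [PrePair.triv_left]; simp)
  let q3 := pairOfProj pML.toPre i3 b a
    (fun m x n => by rw [PrePair.triv_right]; simp)
    (fun m x n => by rw [PrePair.triv_left]; simp)
  let q4 := pairOfProj pMM.toPre i4 b b (fun _ _ _ => rfl) (fun _ _ _ => rfl)
  have e1 : ∀ x y, q1.pair x y = i1.toLinearMap (pLL.pair (a.toLinearMap x) (a.toLinearMap y)) :=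
    fun _ _ => rfl
  have e2 : ∀ x y, q2.pair x y = i2.toLinearMap (pLM.pair (a.toLinearMap x) (b.toLinearMap y)) :=
    fun _ _ => rfl
  have e3 : ∀ x y, q3.pair x y = i3.toLinearMap (pML.pair (b.toLinearMap x) (a.toLinearMap y)) :=
    fun _ _ => rfl
  have e4 : ∀ x y, q4.pair x y = i4.toLinearMap (pMM.pair (b.toLinearMap x) (b.toLinearMap y)) :=
    fun _ _ => rfl
  have h21 := br_zero_symm i1 i2 h12
  have h31 := br_zero_symm i1 i3 h13
  have h41 := br_zero_symm i1 i4 h14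
  have h32 := br_zero_symm i2 i3 h23
  have h42 := br_zero_symm i2 i4 h24
  have h43 := br_zero_symm i3 i4 h34
  let q12 := q1.add' q2 (fun _ _ _ _ => h12 _ _) (fun _ _ _ _ => h21 _ _)
  have e12 : ∀ x y, q12.pair x y = q1.pair x y + q2.pair x y := fun _ _ => rfl
  let q34 := q3.add' q4 (fun _ _ _ _ => h34 _ _) (fun _ _ _ _ => h43 _ _)
  have e34 : ∀ x y, q34.pair x y = q3.pair x y + q4.pair x y := fun _ _ => rfl
  let q := q12.add' q34
    (fun _ _ _ _ => by simp [e12, e34, e1, e2, e3, e4, h13, h14, h23, h24])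
    (fun _ _ _ _ => by simp [e12, e34, e1, e2, e3, e4, h31, h41, h32, h42])
  have e : ∀ x y, q.pair x y = q12.pair x y + q34.pair x y := fun _ _ => rfl
  obtain ⟨Φ, hΦ⟩ := uP.exists_hom q
  -- the backward maps
  obtain ⟨k1, hk1⟩ := u1.exists_hom (pairOfHoms pP.toPre f f
    (fun m n => (f.map_bracket m n).symm) (fun m n => (f.map_bracket n m).symm))
  obtain ⟨k2, hk2⟩ := u2.exists_hom (pairOfHoms pP.toPre f g
    (fun m n => by simp [hfg1]) (fun m n => by simp [hfg2]))
  obtain ⟨k3, hk3⟩ := u3.exists_hom (pairOfHoms pP.toPre g f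
    (fun m n => by simp [hfg2]) (fun m n => by simp [hfg1]))
  obtain ⟨k4, hk4⟩ := u4.exists_hom (pairOfHoms pP.toPre g g
    (fun m n => (g.map_bracket m n).symm) (fun m n => (g.map_bracket n m).symm))
  replace hk1 : ∀ x y, k1.toLinearMap (pLL.pair x y)
    = pP.pair (f.toLinearMap x) (f.toLinearMap y) := hk1
  replace hk2 : ∀ x y, k2.toLinearMap (pLM.pair x y)
    = pP.pair (f.toLinearMap x) (g.toLinearMap y) := hk2
  replace hk3 : ∀ x y, k3.toLinearMap (pML.pair x y)
    = pP.pair (g.toLinearMap x) (f.toLinearMap y) := hk3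
  replace hk4 : ∀ x y, k4.toLinearMap (pMM.pair x y)
    = pP.pair (g.toLinearMap x) (g.toLinearMap y) := hk4
  replace hΦ : ∀ x y, Φ.toLinearMap (pP.pair x y) = q.pair x y := hΦ
  have c1 : ∀ t, Φ.toLinearMap (k1.toLinearMap t) = i1.toLinearMap t :=
    u1.ext (Φ.toLinearMap ∘ₗ k1.toLinearMap) i1.toLinearMap (fun x y => by
      change Φ.toLinearMap (k1.toLinearMap (pLL.pair x y)) = i1.toLinearMap (pLL.pair x y)
      simp [hk1, hΦ, e, e12, e34, e1, e2, e3, e4, haf, hbf])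
  have c2 : ∀ t, Φ.toLinearMap (k2.toLinearMap t) = i2.toLinearMap t :=
    u2.ext (Φ.toLinearMap ∘ₗ k2.toLinearMap) i2.toLinearMap (fun x y => by
      change Φ.toLinearMap (k2.toLinearMap (pLM.pair x y)) = i2.toLinearMap (pLM.pair x y)
      simp [hk2, hΦ, e, e12, e34, e1, e2, e3, e4, haf, hbf, hag, hbg])
  have c3 : ∀ t, Φ.toLinearMap (k3.toLinearMap t) = i3.toLinearMap t :=
    u3.ext (Φ.toLinearMap ∘ₗ k3.toLinearMap) i3.toLinearMap (fun x y => by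
      change Φ.toLinearMap (k3.toLinearMap (pML.pair x y)) = i3.toLinearMap (pML.pair x y)
      simp [hk3, hΦ, e, e12, e34, e1, e2, e3, e4, haf, hbf, hag, hbg])
  have c4 : ∀ t, Φ.toLinearMap (k4.toLinearMap t) = i4.toLinearMap t :=
    u4.ext (Φ.toLinearMap ∘ₗ k4.toLinearMap) i4.toLinearMap (fun x y => by
      change Φ.toLinearMap (k4.toLinearMap (pMM.pair x y)) = i4.toLinearMap (pMM.pair x y)
      simp [hk4, hΦ, e, e12, e34, e1, e2, e3, e4, hag, hbg])
  let I : (TLL × TLM × TML × TMM) →ₗ[F] S :=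
    i1.toLinearMap.coprod (i2.toLinearMap.coprod (i3.toLinearMap.coprod i4.toLinearMap))
  have hI : ∀ t, I t = i1.toLinearMap t.1 + i2.toLinearMap t.2.1 + i3.toLinearMap t.2.2.1
      + i4.toLinearMap t.2.2.2 := fun t => by simp [I]; abel
  let E : (TLL × TLM × TML × TMM) ≃ₗ[F] S := LinearEquiv.ofBijective I (by
    have : (I : _ → S) = _ := funext hI
    rw [this]; exact hi)
  have hE : ∀ t, E t = i1.toLinearMap t.1 + i2.toLinearMap t.2.1 + i3.toLinearMap t.2.2.1
      + i4.toLinearMap t.2.2.2 := hI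
  let K : (TLL × TLM × TML × TMM) →ₗ[F] TP :=
    k1.toLinearMap.coprod (k2.toLinearMap.coprod (k3.toLinearMap.coprod k4.toLinearMap))
  have hK : ∀ t, K t = k1.toLinearMap t.1 + k2.toLinearMap t.2.1 + k3.toLinearMap t.2.2.1
      + k4.toLinearMap t.2.2.2 := fun t => by simp [K]; abel
  let Ψ : S →ₗ[F] TP := K ∘ₗ E.symm.toLinearMap
  have r1 : ∀ s, Φ.toLinearMap (Ψ s) = s := by
    intro s
    obtain ⟨t, rfl⟩ := E.surjective s
    simp only [Ψ, LinearMap.comp_apply, LinearEquiv.coe_coe, E.symm_apply_apply, hK, map_add,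
      c1, c2, c3, c4]
    rw [hE]
  have r2 : ∀ t, Ψ (Φ.toLinearMap t) = t := by
    refine uP.ext (Ψ ∘ₗ Φ.toLinearMap) LinearMap.id (fun x y => ?_)
    change Ψ (Φ.toLinearMap (pP.pair x y)) = pP.pair x y
    have : q.pair x y = E (pLL.pair (a.toLinearMap x) (a.toLinearMap y),
        pLM.pair (a.toLinearMap x) (b.toLinearMap y),
        pML.pair (b.toLinearMap x) (a.toLinearMap y),
        pMM.pair (b.toLinearMap x) (b.toLinearMap y)) := by
      rw [hE, e, e12, e34, e1, e2, e3, e4]; abel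
    rw [hΦ, this]
    simp only [Ψ, LinearMap.comp_apply, LinearEquiv.coe_coe, E.symm_apply_apply, hK, hk1, hk2,
      hk3, hk4]
    conv_rhs => rw [← hab x, ← hab y]
    simp only [map_add, LinearMap.add_apply]
    abel
  exact ⟨Φ, Function.bijective_iff_has_inverse.2 ⟨Ψ, r2, r1⟩⟩
end

section
/- For any Lie superalgebra M over a field of characteristic ≠ 2, 3, the submodule M □ M of M ⊗ M generated by the elements m ⊗ m' + (−1)^{|m||m'|}(m' ⊗ m) for homogeneous m, m' ∈ M and m₀ ⊗ m₀ for m₀ ∈ M₀ is a central graded ideal of the non-abelian tensor square M ⊗ M. -/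
open Module Function TensorProduct

universe u v w x y z

theorem aux_lift {F : Type*} [Field F]
    {M : Type*} [AddCommGroup M] [Module F M] [SuperModule F M] [LieSuperAlgebra F M]
    {T : Type*} [AddCommGroup T] [Module F T] [SuperModule F T] [LieSuperAlgebra F T]
    (p : TensorSqPairing F M T) {V : Type*} [AddCommGroup V] [Module F V]
    (f : V →ₗ[F] T) (hf : Function.Injective f)
    (hbr : ∀ v w : V, br F T (f v) (f w) ∈ LinearMap.range f)
    (hp : ∀ x y : M, p.pair x y ∈ LinearMap.range f)
    (hg : ∀ v : V, ∃ v0 v1 : V, f v0 ∈ gr F T 0 ∧ f v1 ∈ gr F T 1 ∧ v0 + v1 = v) :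
    ∃ (_ : SuperModule F V) (_ : LieSuperAlgebra F V) (g : LieSuperHom F V T)
      (q : TensorSqPairing F M V), g.toLinearMap = f ∧
      (∀ x y, f (q.pair x y) = p.pair x y) ∧
      (∀ (a : ZMod 2) (v : V), f v ∈ gr F T a → v ∈ gr F V a) := by
  choose B hB using hbr
  choose Q hQ using hp
  let i1 : SuperModule F V :=
    { grade := fun a => (gr F T a).comap f
      isCompl_grade := by
        constructor
        · rw [Submodule.disjoint_def]
          intro x h0 h1
          apply hf
          rw [map_zero]
          exact (Submodule.disjoint_def.1
            (SuperModule.isCompl_grade (F := F) (V := T)).disjoint) _ h0 h1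
        · rw [codisjoint_iff, eq_top_iff]
          intro v _
          obtain ⟨v0, v1, h0, h1, rfl⟩ := hg v
          exact Submodule.add_mem_sup h0 h1 }
  let i2 : LieSuperAlgebra F V :=
    { bracket := LinearMap.mk₂ F B
        (fun a b c => hf (by simp [hB])) (fun a b c => hf (by simp [hB]))
        (fun a b c => hf (by simp [hB])) (fun a b c => hf (by simp [hB]))
      bracket_grade := by
        intro a b x y hx hy
        change f (B x y) ∈ gr F T (a + b)
        rw [hB]
        exact LieSuperAlgebra.bracket_grade a b _ _ hx hy
      skew := by
        intro a b x y hx hy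
        apply hf
        simp only [LinearMap.mk₂_apply, map_smul, hB]
        exact LieSuperAlgebra.skew a b _ _ hx hy
      jacobi := by
        intro a b c x y z hx hy hz
        apply hf
        simp only [LinearMap.mk₂_apply, map_smul, map_add, map_zero, hB]
        exact LieSuperAlgebra.jacobi a b c _ _ _ hx hy hz }
  have hB' : ∀ v w, f (br F V v w) = br F T (f v) (f w) := fun v w => hB v w
  refine ⟨i1, i2, ⟨f, fun a x hx => hx, hB'⟩,
    { pair := LinearMap.mk₂ F Q
        (fun a b c => hf (by simp [hQ])) (fun a b c => hf (by simp [hQ]))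
        (fun a b c => hf (by simp [hQ])) (fun a b c => hf (by simp [hQ]))
      pair_grade := ?_, rel1 := ?_, rel2 := ?_, rel3 := ?_ }, rfl, fun x y => hQ x y,
      fun a v h => h⟩
  · intro a b x y hx hy
    change f (Q x y) ∈ gr F T (a + b)
    rw [hQ]
    exact p.pair_grade a b _ _ hx hy
  · intro a b x x' y hx hy
    apply hf
    simp only [LinearMap.mk₂_apply, map_smul, map_sub, hQ]
    exact p.rel1 a b _ _ _ hx hy
  · intro a b c x y z hx hy hz
    apply hf
    simp only [LinearMap.mk₂_apply, map_smul, map_sub, hQ]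
    exact p.rel2 a b c _ _ _ hx hy hz
  · intro a b x y x' y' hx hy
    apply hf
    rw [hB']
    simp only [LinearMap.mk₂_apply, map_smul, hQ]
    exact p.rel3 a b _ _ _ _ hx hy

theorem aux_dec (F : Type*) [Field F] {M : Type*} [AddCommGroup M] [Module F M]
    [SuperModule F M] (x : M) : ∃ x0 ∈ gr F M 0, ∃ x1 ∈ gr F M 1, x0 + x1 = x := by
  have h : x ∈ gr F M 0 ⊔ gr F M 1 := by
    have := (SuperModule.isCompl_grade (F := F) (V := M)).sup_eq_top
    rw [this]; trivial
  exact Submodule.mem_sup.1 h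

def homPairs {F : Type*} [Field F]
    {M : Type*} [AddCommGroup M] [Module F M] [SuperModule F M] [LieSuperAlgebra F M]
    {T : Type*} [AddCommGroup T] [Module F T] [SuperModule F T] [LieSuperAlgebra F T]
    (p : TensorSqPairing F M T) : Set T :=
  {t | ∃ (a b : ZMod 2) (x y : M), x ∈ gr F M a ∧ y ∈ gr F M b ∧ t = p.pair x y}

theorem aux_graded {F : Type*} [Field F]
    {T : Type*} [AddCommGroup T] [Module F T] [SuperModule F T] (P : Set T)
    (hP : ∀ t ∈ P, ∃ c, t ∈ gr F T c) : IsGradedSub F (Submodule.span F P) := by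
  unfold IsGradedSub
  rw [Submodule.span_le]
  intro t ht
  obtain ⟨c, hc⟩ := hP t ht
  have hs := Submodule.subset_span (R := F) ht
  fin_cases c
  · exact Submodule.mem_sup_left ⟨hs, hc⟩
  · exact Submodule.mem_sup_right ⟨hs, hc⟩

theorem aux_pair_mem {F : Type*} [Field F]
    {M : Type*} [AddCommGroup M] [Module F M] [SuperModule F M] [LieSuperAlgebra F M]
    {T : Type*} [AddCommGroup T] [Module F T] [SuperModule F T] [LieSuperAlgebra F T]
    (p : TensorSqPairing F M T) (x y : M) : p.pair x y ∈ Submodule.span F (homPairs p) := by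
  obtain ⟨x0, hx0, x1, hx1, rfl⟩ := aux_dec F x
  obtain ⟨y0, hy0, y1, hy1, rfl⟩ := aux_dec F y
  simp only [map_add, LinearMap.add_apply]
  refine add_mem (add_mem ?_ ?_) (add_mem ?_ ?_) <;> apply Submodule.subset_span
  · exact ⟨_, _, _, _, hx0, hy0, rfl⟩
  · exact ⟨_, _, _, _, hx1, hy0, rfl⟩
  · exact ⟨_, _, _, _, hx0, hy1, rfl⟩
  · exact ⟨_, _, _, _, hx1, hy1, rfl⟩

theorem aux_span {F : Type u} [Field F]
    {M : Type v} [AddCommGroup M] [Module F M] [SuperModule F M] [LieSuperAlgebra F M]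
    {T : Type w} [AddCommGroup T] [Module F T] [SuperModule F T] [LieSuperAlgebra F T]
    (p : TensorSqPairing F M T) (hT : IsTensorSquare F M T p) :
    Submodule.span F (homPairs p) = ⊤ := by
  set S := Submodule.span F (homPairs p) with hS
  have hSbr : ∀ v ∈ S, ∀ w ∈ S, br F T v w ∈ S := by
    intro v hv w hw
    induction hv using Submodule.span_induction with
    | zero => simp
    | add a b _ _ ha hb => simpa using add_mem ha hb
    | smul c a _ ha => simpa using S.smul_mem c ha
    | mem v hv =>
      obtain ⟨a, b, x, y, hx, hy, rfl⟩ := hv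
      induction hw using Submodule.span_induction with
      | zero => simp
      | add a b _ _ ha hb => simpa using add_mem ha hb
      | smul c a _ ha => simpa using S.smul_mem c ha
      | mem w hw =>
        obtain ⟨a', b', x', y', hx', hy', rfl⟩ := hw
        rw [p.rel3 a b x y x' y' hx hy]
        exact S.smul_mem _ (aux_pair_mem p _ _)
  have hSg : IsGradedSub F S := aux_graded _ (by
    rintro t ⟨a, b, x, y, hx, hy, rfl⟩
    exact ⟨_, p.pair_grade a b x y hx hy⟩)
  let f : ULift.{max u v} S →ₗ[F] T := S.subtype ∘ₗ ULift.moduleEquiv.toLinearMap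
  have hfr : ∀ t ∈ S, ∃ v, f v = t := fun t ht => ⟨ULift.up ⟨t, ht⟩, rfl⟩
  have hfS : ∀ v, f v ∈ S := fun v => v.down.2
  have hfi : Function.Injective f := fun a b h => ULift.down_injective (Subtype.ext h)
  obtain ⟨i1, i2, g, q, hgf, hq, -⟩ := aux_lift p f hfi
    (fun v w => hfr _ (hSbr _ (hfS v) _ (hfS w)))
    (fun x y => hfr _ (aux_pair_mem p x y))
    (fun v => by
      obtain ⟨t0, h0, t1, h1, h⟩ := Submodule.mem_sup.1 (hSg (hfS v))
      obtain ⟨v0, rfl⟩ := hfr t0 h0.1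
      obtain ⟨v1, rfl⟩ := hfr t1 h1.1
      exact ⟨v0, v1, h0.2, h1.2, hfi (by rw [map_add, h])⟩)
  obtain ⟨h, hh, -⟩ := hT (ULift.{max u v} S) q
  let f' : ULift.{max u v} T →ₗ[F] T := ULift.moduleEquiv.toLinearMap
  have hfi' : Function.Injective f' := fun a b h => ULift.down_injective h
  obtain ⟨j1, j2, g', q', hgf', hq', hl⟩ := aux_lift p f' hfi'
    (fun v w => ⟨ULift.up _, rfl⟩)
    (fun x y => ⟨ULift.up _, rfl⟩)
    (fun v => by
      obtain ⟨t0, h0, t1, h1, h⟩ := aux_dec F (f' v)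
      exact ⟨ULift.up t0, ULift.up t1, h0, h1, hfi' h⟩)
  have hb' : ∀ v w, f' (br F _ v w) = br F T (f' v) (f' w) := by
    intro v w
    have := g'.map_bracket v w
    rwa [hgf'] at this
  let up : T →ₗ[F] ULift.{max u v} T := ULift.moduleEquiv.symm.toLinearMap
  have hup : ∀ t, f' (up t) = t := fun t => rfl
  let k1 : LieSuperHom F T (ULift.{max u v} T) :=
    { toLinearMap := up
      map_grade := fun a x hx => hl a _ hx
      map_bracket := fun x y => hfi' (by rw [hb', hup, hup, hup]) }
  let k2 : LieSuperHom F T (ULift.{max u v} T) :=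
    { toLinearMap := up ∘ₗ f ∘ₗ h.toLinearMap
      map_grade := fun a x hx => hl a _ (by
        have := g.map_grade a _ (h.map_grade a x hx)
        rw [hgf] at this
        exact this)
      map_bracket := fun x y => hfi' (by
        have := g.map_bracket (h.toLinearMap x) (h.toLinearMap y)
        rw [hgf] at this
        rw [hb']
        simp only [LinearMap.comp_apply, hup]
        rw [h.map_bracket, this]) }
  have hk : k1 = k2 := (hT (ULift.{max u v} T) q').unique
    (fun x y => hfi' (by rw [hq']; rfl))
    (fun x y => hfi' (by
      rw [hq']
      change f (h.toLinearMap (p.pair x y)) = _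
      rw [hh, hq]))
  rw [eq_top_iff]
  intro t _
  have h3 : f' (k1.toLinearMap t) = f' (k2.toLinearMap t) := by rw [hk]
  have h4 : t = f (h.toLinearMap t) := h3
  rw [h4]
  exact hfS _

theorem stmt_11 (F : Type*) [Field F] (hchar2 : ringChar F ≠ 2) (hchar3 : ringChar F ≠ 3)
    (M : Type*) [AddCommGroup M] [Module F M] [SuperModule F M] [LieSuperAlgebra F M]
    (T : Type*) [AddCommGroup T] [Module F T] [SuperModule F T] [LieSuperAlgebra F T]
    (p : TensorSqPairing F M T) (hT : IsTensorSquare F M T p) :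
    IsGradedSub F (squareBox F M T p) ∧
    (∀ t ∈ squareBox F M T p, ∀ s : T, br F T t s = 0 ∧ br F T s t = 0) := by
  have h2 : (2 : F) ≠ 0 := Ring.two_ne_zero hchar2
  have hgen : ∀ t ∈ ({t | ∃ (a b : ZMod 2) (x y : M), x ∈ gr F M a ∧ y ∈ gr F M b ∧
        t = p.pair x y + sgn F a b • p.pair y x} ∪
      {t | ∃ x ∈ gr F M 0, t = p.pair x x} : Set T), ∃ c, t ∈ gr F T c := by
    rintro t (⟨a, b, x, y, hx, hy, rfl⟩ | ⟨x, hx, rfl⟩)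
    · refine ⟨a + b, add_mem (p.pair_grade _ _ _ _ hx hy) (Submodule.smul_mem _ _ ?_)⟩
      rw [add_comm a b]
      exact p.pair_grade _ _ _ _ hy hx
    · exact ⟨_, p.pair_grade _ _ _ _ hx hx⟩
  refine ⟨aux_graded _ hgen, ?_⟩
  have hsgn : ∀ a b, sgn F a b * sgn F a b = 1 := by
    intro a b; unfold sgn; split_ifs <;> simp
  have hcomm : ∀ a b, sgn F a b = sgn F b a := by
    intro a b; unfold sgn; simp only [and_comm]
  have key : ∀ t ∈ ({t | ∃ (a b : ZMod 2) (x y : M), x ∈ gr F M a ∧ y ∈ gr F M b ∧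
        t = p.pair x y + sgn F a b • p.pair y x} ∪
      {t | ∃ x ∈ gr F M 0, t = p.pair x x} : Set T), ∀ x' y', br F T t (p.pair x' y') = 0 := by
    rintro t (⟨a, b, x, y, hx, hy, rfl⟩ | ⟨x, hx, rfl⟩) x' y'
    · rw [map_add, map_smul, LinearMap.add_apply, LinearMap.smul_apply,
        p.rel3 a b x y x' y' hx hy, p.rel3 b a y x x' y' hy hx,
        LieSuperAlgebra.skew a b x y hx hy, ← hcomm a b]
      simp only [map_smul, LinearMap.smul_apply, smul_smul]
      rw [← add_smul]
      have : -sgn F a b + sgn F a b * (-sgn F a b * -sgn F a b) = 0 := by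
        linear_combination (sgn F a b) * hsgn a b
      first
        | rw [this, zero_smul]
        | (rw [mul_assoc, this, zero_smul])
    · have hxx : br F M x x = 0 := by
        have h := LieSuperAlgebra.skew (F := F) 0 0 x x hx hx
        have h0 : sgn F 0 0 = 1 := by simp [sgn]
        rw [h0, neg_smul, one_smul, eq_neg_iff_add_eq_zero, ← two_smul F] at h
        exact (smul_eq_zero.1 h).resolve_left h2
      rw [p.rel3 0 0 x x x' y' hx hx, hxx]
      simp
  have hspan := aux_span p hT
  intro t ht s
  have hs : s ∈ Submodule.span F (homPairs p) := by rw [hspan]; trivial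
  induction ht using Submodule.span_induction with
  | zero => simp
  | add a b _ _ ha hb => simp [ha.1, ha.2, hb.1, hb.2]
  | smul c a _ ha => simp [ha.1, ha.2]
  | mem t ht =>
    induction hs using Submodule.span_induction with
    | zero => simp
    | add a b _ _ ha hb => simp [ha.1, ha.2, hb.1, hb.2]
    | smul c a _ ha => simp [ha.1, ha.2]
    | mem s hs =>
      obtain ⟨a, b, x, y, hx, hy, rfl⟩ := hs
      obtain ⟨c, hc⟩ := hgen t ht
      have h1 := key t ht x y
      refine ⟨h1, ?_⟩
      rw [LieSuperAlgebra.skew _ c _ _ (p.pair_grade _ _ _ _ hx hy) hc, h1, smul_zero]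
end

section
/- Every Heisenberg Lie superalgebra with odd-central generator over a field of characteristic ≠ 2, 3 has dimension (m | m + 1) for some m ≥ 1 and is isomorphic to H_m. Moreover, the Schur multiplier satisfies dim M(H_m) = (m² | m² − 1) if m ≥ 2, and dim M(H₁) = (1 | 1). -/
open Module Function TensorProduct

universe u v w x y z

/-! ### Auxiliary material -/

theorem zmod2_cases (a : ZMod 2) : a = 0 ∨ a = 1 := by revert a; decide

theorem LieSuperHom.ext' {F : Type u} {L : Type v} {M : Type w} [Field F]
    [AddCommGroup L] [Module F L] [SuperModule F L] [LieSuperAlgebra F L]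
    [AddCommGroup M] [Module F M] [SuperModule F M] [LieSuperAlgebra F M]
    {f g : LieSuperHom F L M} (h : f.toLinearMap = g.toLinearMap) : f = g := by
  cases f; cases g; cases h; rfl

/-- transport of a grading -/
@[reducible] def transSM (F : Type u) {L : Type v} {L' : Type w} [Field F]
    [AddCommGroup L] [Module F L] [SuperModule F L]
    [AddCommGroup L'] [Module F L'] (e : L ≃ₗ[F] L') : SuperModule F L' where
  grade a := (gr F L a).comap e.symm.toLinearMap
  isCompl_grade := by
    have h := SuperModule.isCompl_grade (F := F) (V := L)
    exact (Submodule.orderIsoMapComap e.symm).symm.isCompl h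

theorem transSM_mem (F : Type u) {L : Type v} {L' : Type w} [Field F]
    [AddCommGroup L] [Module F L] [SuperModule F L]
    [AddCommGroup L'] [Module F L'] (e : L ≃ₗ[F] L') (a : ZMod 2) (x : L') :
    letI := transSM F e
    (x ∈ gr F L' a ↔ e.symm x ∈ gr F L a) := Iff.rfl

/-- transport of a bracket -/
@[reducible] def transLSA (F : Type u) {L : Type v} {L' : Type w} [Field F]
    [AddCommGroup L] [Module F L] [SuperModule F L] [LieSuperAlgebra F L]
    [AddCommGroup L'] [Module F L'] (e : L ≃ₗ[F] L') :
    letI := transSM F e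
    LieSuperAlgebra F L' :=
  letI := transSM F e
  { bracket := ((br F L).compl₁₂ e.symm.toLinearMap e.symm.toLinearMap).compr₂ e.toLinearMap
    bracket_grade := by
      intro a b x y hx hy
      rw [transSM_mem] at *
      simpa using LieSuperAlgebra.bracket_grade a b _ _ hx hy
    skew := by
      intro a b x y hx hy
      rw [transSM_mem] at *
      have := congrArg e (LieSuperAlgebra.skew a b _ _ hx hy)
      simpa using this
    jacobi := by
      intro a b c x y z hx hy hz
      rw [transSM_mem] at *
      have := congrArg e (LieSuperAlgebra.jacobi a b c _ _ _ hx hy hz)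
      simpa using this }

theorem free_lift {F : Type u} {X : Type v} {deg : X → ZMod 2} {Fr : Type w} [Field F]
    [AddCommGroup Fr] [Module F Fr] [SuperModule F Fr] [LieSuperAlgebra F Fr]
    {ι : X → Fr} (hF : IsFreeLSA F X deg Fr ι)
    (K : Type x) [AddCommGroup K] [Module F K] [SuperModule F K]
    [LieSuperAlgebra F K] [FiniteDimensional F K]
    (f : X → K) (hf : ∀ x : X, f x ∈ gr F K (deg x)) :
    ∃! h : LieSuperHom F Fr K, ∀ x : X, h.toLinearMap (ι x) = f x := by
  let b := (finBasis F K).reindex (Equiv.ulift.{max v w}).symm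
  let e : K ≃ₗ[F] (ULift.{max v w} (Fin (finrank F K)) → F) := b.equivFun
  let i1 := transSM F e
  let i2 := transLSA F e
  have hbr : ∀ x y : K, br F _ (e x) (e y) = e (br F K x y) := by
    intro x y
    change e (br F K (e.symm (e x)) (e.symm (e y))) = _
    simp
  obtain ⟨h, hh, hu⟩ := hF.2 (ULift.{max v w} (Fin (finrank F K)) → F) (fun x => e (f x))
    (fun x => by rw [transSM_mem]; simpa using hf x)
  refine ⟨⟨e.symm.toLinearMap ∘ₗ h.toLinearMap, ?_, ?_⟩, ?_, ?_⟩
  · intro a x hx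
    exact h.map_grade a x hx
  · intro x y
    simp only [LinearMap.comp_apply, LinearEquiv.coe_coe]
    rw [h.map_bracket, LinearEquiv.symm_apply_eq, ← hbr]
    simp
  · intro x
    simp [hh]
  · intro g hg
    have := hu ⟨e.toLinearMap ∘ₗ g.toLinearMap, ?_, ?_⟩ ?_
    · apply LieSuperHom.ext'
      ext x
      have := congrArg (fun k => k.toLinearMap x) this
      simp only [LinearMap.comp_apply, LinearEquiv.coe_coe] at this ⊢
      rw [← this]; simp
    · intro a x hx
      rw [transSM_mem]
      simpa using g.map_grade a x hx
    · intro x y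
      simp only [LinearMap.comp_apply, LinearEquiv.coe_coe]
      rw [g.map_bracket, hbr]
    · intro x
      simp [hg]

/-- grading on the extension -/
@[reducible] def extSM (F : Type u) (L : Type v) [Field F]
    [AddCommGroup L] [Module F L] [SuperModule F L] (p : ZMod 2) : SuperModule F (L × F) where
  grade a := (gr F L a).prod (if a = p then ⊤ else ⊥)
  isCompl_grade := by
    have h := SuperModule.isCompl_grade (F := F) (V := L)
    constructor
    · rw [disjoint_iff, Submodule.prod_inf_prod, disjoint_iff.1 h.disjoint]
      rcases zmod2_cases p with rfl | rfl <;> simp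
    · rw [codisjoint_iff, Submodule.prod_sup_prod, codisjoint_iff.1 h.codisjoint]
      rcases zmod2_cases p with rfl | rfl <;> simp

theorem extSM_mem (F : Type u) (L : Type v) [Field F]
    [AddCommGroup L] [Module F L] [SuperModule F L] (p a : ZMod 2) (x : L × F) :
    letI := extSM F L p
    (x ∈ gr F (L × F) a ↔ x.1 ∈ gr F L a ∧ (a ≠ p → x.2 = 0)) := by
  change x ∈ (gr F L a).prod (if a = p then ⊤ else ⊥) ↔ _
  by_cases h : a = p <;> simp [Submodule.mem_prod, h]

/-- scalar cocycles of parity `p` -/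
structure IsCocyc (F : Type u) (L : Type v) [Field F]
    [AddCommGroup L] [Module F L] [SuperModule F L] [LieSuperAlgebra F L] (p : ZMod 2)
    (c : L →ₗ[F] L →ₗ[F] F) : Prop where
  grade : ∀ (a b : ZMod 2) (x y : L), x ∈ gr F L a → y ∈ gr F L b → a + b ≠ p → c x y = 0
  skew : ∀ (a b : ZMod 2) (x y : L), x ∈ gr F L a → y ∈ gr F L b →
    c x y = -(sgn F a b) * c y x
  jacobi : ∀ (a b d : ZMod 2) (x y zz : L), x ∈ gr F L a → y ∈ gr F L b → zz ∈ gr F L d →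
    sgn F a d * c x (br F L y zz) + sgn F b a * c y (br F L zz x)
      + sgn F d b * c zz (br F L x y) = 0

/-- the extension -/
@[reducible] def extLSA (F : Type u) (L : Type v) [Field F]
    [AddCommGroup L] [Module F L] [SuperModule F L] [LieSuperAlgebra F L] (p : ZMod 2)
    (c : L →ₗ[F] L →ₗ[F] F) (hc : IsCocyc F L p c) :
    letI := extSM F L p
    LieSuperAlgebra F (L × F) :=
  letI := extSM F L p
  { bracket := LinearMap.mk₂ F (fun u v => (br F L u.1 v.1, c u.1 v.1))
      (by intros; simp) (by intros; simp) (by intros; simp) (by intros; simp)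
    bracket_grade := by
      intro a b x y hx hy
      rw [extSM_mem] at *
      exact ⟨LieSuperAlgebra.bracket_grade a b _ _ hx.1 hy.1, hc.grade a b _ _ hx.1 hy.1⟩
    skew := by
      intro a b x y hx hy
      rw [extSM_mem] at *
      ext
      · simpa using LieSuperAlgebra.skew a b _ _ hx.1 hy.1
      · simpa using hc.skew a b _ _ hx.1 hy.1
    jacobi := by
      intro a b c x y z hx hy hz
      rw [extSM_mem] at *
      ext
      · simpa using LieSuperAlgebra.jacobi a b c _ _ _ hx.1 hy.1 hz.1
      · simpa using hc.jacobi a b c _ _ _ hx.1 hy.1 hz.1 }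

theorem exists_omega {F : Type u} {X : Type v} {deg : X → ZMod 2} {Fr : Type w} [Field F]
    [AddCommGroup Fr] [Module F Fr] [SuperModule F Fr] [LieSuperAlgebra F Fr]
    {ι : X → Fr} (hF : IsFreeLSA F X deg Fr ι)
    {L : Type x} [AddCommGroup L] [Module F L] [SuperModule F L]
    [LieSuperAlgebra F L] [FiniteDimensional F L] (φ : LieSuperHom F Fr L) (p : ZMod 2)
    (c : L →ₗ[F] L →ₗ[F] F) (hc : IsCocyc F L p c) :
    ∃ ω : Fr →ₗ[F] F, ∀ u v, ω (br F Fr u v) = c (φ.toLinearMap u) (φ.toLinearMap v) := by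
  let i1 := extSM F L p
  let i2 := extLSA F L p c hc
  have hbr : ∀ u v : L × F, br F (L × F) u v = (br F L u.1 v.1, c u.1 v.1) := fun u v => rfl
  obtain ⟨h, hh, -⟩ := free_lift hF (L × F) (fun x => (φ.toLinearMap (ι x), 0))
    (fun x => by rw [extSM_mem]; exact ⟨φ.map_grade _ _ (hF.1 x), fun _ => rfl⟩)
  let g : LieSuperHom F Fr L := ⟨LinearMap.fst F L F ∘ₗ h.toLinearMap,
    fun a x hx => ((extSM_mem F L p a _).1 (h.map_grade a x hx)).1,
    fun x y => by simp only [LinearMap.comp_apply, h.map_bracket, hbr]; rfl⟩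
  obtain ⟨k, -, hu⟩ := free_lift hF L (fun x => φ.toLinearMap (ι x))
    (fun x => φ.map_grade _ _ (hF.1 x))
  have e1 : g = φ := by
    rw [hu g (fun x => by simp [g, hh]), hu φ (fun x => rfl)]
  refine ⟨LinearMap.snd F L F ∘ₗ h.toLinearMap, fun u v => ?_⟩
  have e2 : ∀ u, (h.toLinearMap u).1 = φ.toLinearMap u := fun u => by rw [← e1]; rfl
  simp only [LinearMap.comp_apply, h.map_bracket, hbr, e2]; rfl

theorem gr_disj {F : Type u} {L : Type v} [Field F]
    [AddCommGroup L] [Module F L] [SuperModule F L] {x : L} (h0 : x ∈ gr F L 0)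
    (h1 : x ∈ gr F L 1) : x = 0 :=
  Submodule.disjoint_def.1 (SuperModule.isCompl_grade (F := F) (V := L)).disjoint x h0 h1

theorem gr_decomp (F : Type u) {L : Type v} [Field F]
    [AddCommGroup L] [Module F L] [SuperModule F L] (x : L) :
    ∃ x0 ∈ gr F L 0, ∃ x1 ∈ gr F L 1, x0 + x1 = x := by
  have h := (SuperModule.isCompl_grade (F := F) (V := L)).codisjoint
  exact Submodule.mem_sup.1 (by rw [codisjoint_iff.1 h]; trivial)

theorem mem_center {F : Type u} {L : Type v} [Field F]
    [AddCommGroup L] [Module F L] [SuperModule F L] [LieSuperAlgebra F L] (x : L) :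
    x ∈ centerSub F L ↔ ∀ y, br F L x y = 0 := by
  simp [centerSub]

theorem br_skew00 {F : Type u} {L : Type v} [Field F]
    [AddCommGroup L] [Module F L] [SuperModule F L] [LieSuperAlgebra F L] {x y : L}
    (hx : x ∈ gr F L 0) (hy : y ∈ gr F L 0) : br F L x y = - br F L y x := by
  simpa [sgn] using LieSuperAlgebra.skew 0 0 x y hx hy

theorem br_skew01 {F : Type u} {L : Type v} [Field F]
    [AddCommGroup L] [Module F L] [SuperModule F L] [LieSuperAlgebra F L] {x y : L}
    (hx : x ∈ gr F L 0) (hy : y ∈ gr F L 1) : br F L x y = - br F L y x := by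
  simpa [sgn] using LieSuperAlgebra.skew 0 1 x y hx hy

theorem br_skew10 {F : Type u} {L : Type v} [Field F]
    [AddCommGroup L] [Module F L] [SuperModule F L] [LieSuperAlgebra F L] {x y : L}
    (hx : x ∈ gr F L 1) (hy : y ∈ gr F L 0) : br F L x y = - br F L y x := by
  simpa [sgn] using LieSuperAlgebra.skew 1 0 x y hx hy

theorem br_skew11 {F : Type u} {L : Type v} [Field F]
    [AddCommGroup L] [Module F L] [SuperModule F L] [LieSuperAlgebra F L] {x y : L}
    (hx : x ∈ gr F L 1) (hy : y ∈ gr F L 1) : br F L x y = br F L y x := by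
  simpa [sgn] using LieSuperAlgebra.skew 1 1 x y hx hy

theorem br_gr00 {F : Type u} {L : Type v} [Field F]
    [AddCommGroup L] [Module F L] [SuperModule F L] [LieSuperAlgebra F L] {x y : L}
    (hx : x ∈ gr F L 0) (hy : y ∈ gr F L 0) : br F L x y ∈ gr F L 0 :=
  LieSuperAlgebra.bracket_grade 0 0 x y hx hy

theorem br_gr01 {F : Type u} {L : Type v} [Field F]
    [AddCommGroup L] [Module F L] [SuperModule F L] [LieSuperAlgebra F L] {x y : L}
    (hx : x ∈ gr F L 0) (hy : y ∈ gr F L 1) : br F L x y ∈ gr F L 1 :=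
  LieSuperAlgebra.bracket_grade 0 1 x y hx hy

theorem br_gr10 {F : Type u} {L : Type v} [Field F]
    [AddCommGroup L] [Module F L] [SuperModule F L] [LieSuperAlgebra F L] {x y : L}
    (hx : x ∈ gr F L 1) (hy : y ∈ gr F L 0) : br F L x y ∈ gr F L 1 :=
  LieSuperAlgebra.bracket_grade 1 0 x y hx hy

theorem br_gr11 {F : Type u} {L : Type v} [Field F]
    [AddCommGroup L] [Module F L] [SuperModule F L] [LieSuperAlgebra F L] {x y : L}
    (hx : x ∈ gr F L 1) (hy : y ∈ gr F L 1) : br F L x y ∈ gr F L 0 :=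
  LieSuperAlgebra.bracket_grade 1 1 x y hx hy

theorem heis_class (F : Type u) [Field F]
    (L : Type v) [AddCommGroup L] [Module F L] [SuperModule F L] [LieSuperAlgebra F L]
    [FiniteDimensional F L] (hH : IsHeisenbergOdd F L) :
    ∃ m : ℕ, 1 ≤ m ∧ finrank F (gr F L 0) = m ∧ finrank F (gr F L 1) = m + 1 ∧
      IsHmOdd F m L := by
  obtain ⟨hcd, z, hz0, hz1, hcz⟩ := hH
  have hcen : ∀ x : L, (∀ y, br F L x y = 0) → ∃ c : F, c • z = x := by
    intro x hx
    exact Submodule.mem_span_singleton.1 (hcz ▸ (mem_center x).2 hx)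
  have hbz : ∀ x y : L, ∃ c : F, c • z = br F L x y := by
    intro x y
    apply Submodule.mem_span_singleton.1
    rw [← hcz, hcd]
    exact Submodule.subset_span ⟨x, y, rfl⟩
  have hzl : ∀ y, br F L z y = 0 :=
    (mem_center z).1 (hcz ▸ Submodule.mem_span_singleton_self z)
  have hzr : ∀ y, br F L y z = 0 := by
    intro y
    obtain ⟨y0, h0, y1, h1, rfl⟩ := gr_decomp F y
    simp [br_skew01 h0 hz1, br_skew11 h1 hz1, hzl]
  have even0 : ∀ (c : F), c • z ∈ gr F L 0 → c • z = 0 := fun c h =>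
    gr_disj h ((gr F L 1).smul_mem c hz1)
  have b00 : ∀ x ∈ gr F L 0, ∀ y ∈ gr F L 0, br F L x y = 0 := by
    intro x hx y hy
    obtain ⟨c, hc⟩ := hbz x y
    rw [← hc]; apply even0; rw [hc]; exact br_gr00 hx hy
  have b11 : ∀ x ∈ gr F L 1, ∀ y ∈ gr F L 1, br F L x y = 0 := by
    intro x hx y hy
    obtain ⟨c, hc⟩ := hbz x y
    rw [← hc]; apply even0; rw [hc]; exact br_gr11 hx hy
  obtain ⟨f, hf⟩ : ∃ f : L →ₗ[F] F, f z = 1 := by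
    obtain ⟨f, hf⟩ := Module.Projective.exists_dual_ne_zero F hz0
    exact ⟨(f z)⁻¹ • f, by simp [hf]⟩
  have hfb : ∀ x y, br F L x y = f (br F L x y) • z := by
    intro x y
    obtain ⟨c, hc⟩ := hbz x y
    rw [← hc]; simp [hf]
  let m := finrank F (gr F L 0)
  let B0 := finBasis F (gr F L 0)
  let xv : Fin m → L := fun i => (B0 i : L)
  have hxv : ∀ i, xv i ∈ gr F L 0 := fun i => (B0 i).2
  let ψ : L →ₗ[F] (Fin m → F) := LinearMap.pi (fun i => f ∘ₗ br F L (xv i))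
  have hψ : ∀ y i, ψ y i = f (br F L (xv i) y) := fun y i => rfl
  have hxspan : ∀ x ∈ gr F L 0, ∃ a : Fin m → F, x = ∑ i, a i • xv i := by
    intro x hx
    refine ⟨B0.repr ⟨x, hx⟩, ?_⟩
    have := congrArg (Submodule.subtype _) (B0.sum_repr ⟨x, hx⟩)
    rw [map_sum] at this
    simpa [xv] using this.symm
  have hxli : ∀ a : Fin m → F, ∑ i, a i • xv i = 0 → a = 0 := by
    intro a ha
    have := Fintype.linearIndependent_iff.1 B0.linearIndependent a (by
      apply Subtype.ext
      simpa [xv] using ha)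
    exact funext this
  have hψs : LinearMap.range ψ = ⊤ := by
    by_contra hne
    obtain ⟨g, hg0, hg⟩ := Submodule.exists_le_ker_of_lt_top _ (lt_top_iff_ne_top.2 hne)
    apply hg0
    let a : Fin m → F := fun i => g (Pi.single i 1)
    have hga : ∀ v, g v = ∑ i, a i * v i := by
      intro v
      conv_lhs => rw [pi_eq_sum_univ' v]
      rw [map_sum]
      apply Finset.sum_congr rfl
      intro i _
      rw [map_smul, smul_eq_mul, mul_comm]
    have key : ∑ i, a i • xv i = 0 := by
      have hmem : ∑ i, a i • xv i ∈ gr F L 0 :=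
        Submodule.sum_mem _ fun i _ => Submodule.smul_mem _ _ (hxv i)
      obtain ⟨c, hc⟩ := hcen (∑ i, a i • xv i) (by
        intro y
        rw [hfb]
        have : g (ψ y) = 0 := hg ⟨y, rfl⟩
        rw [hga] at this
        simp only [hψ] at this
        simp [map_sum, LinearMap.sum_apply, this])
      rw [← hc] at hmem ⊢
      exact even0 c hmem
    ext i
    have := congrFun (hxli a key) i
    simpa [a] using this
  have hy : ∀ j : Fin m, ∃ y ∈ gr F L 1, ∀ i, f (br F L (xv i) y) = if i = j then 1 else 0 := by
    intro j
    obtain ⟨y, hy⟩ := LinearMap.range_eq_top.1 hψs (Pi.single j 1)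
    obtain ⟨y0, h0, y1, h1, rfl⟩ := gr_decomp F y
    refine ⟨y1, h1, fun i => ?_⟩
    have := congrFun hy i
    rw [hψ, map_add, b00 _ (hxv i) _ h0, zero_add] at this
    rw [this, Pi.single_apply]
  choose yv hyv hxy using hy
  let bv : Fin m ⊕ Fin m ⊕ Unit → L := Sum.elim xv (Sum.elim yv (fun _ => z))
  have hxyz : ∀ i j, br F L (xv i) (yv j) = if i = j then z else 0 := by
    intro i j
    rw [hfb, hxy]; split_ifs <;> simp
  have hli : LinearIndependent F bv := by
    rw [Fintype.linearIndependent_iff]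
    intro g hg
    simp only [Fintype.sum_sum_type, bv, Sum.elim_inl, Sum.elim_inr, Finset.univ_unique,
      Finset.sum_singleton] at hg
    set X := ∑ i, g (Sum.inl i) • xv i with hX
    have hX0 : X ∈ gr F L 0 := Submodule.sum_mem _ fun i _ => Submodule.smul_mem _ _ (hxv i)
    have hX1 : X ∈ gr F L 1 := by
      rw [eq_neg_of_add_eq_zero_left hg]
      apply Submodule.neg_mem
      apply Submodule.add_mem
      · exact Submodule.sum_mem _ fun i _ => Submodule.smul_mem _ _ (hyv i)
      · exact Submodule.smul_mem _ _ hz1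
    have hXz := gr_disj hX0 hX1
    have ha := hxli _ hXz
    rw [hXz, zero_add] at hg
    have hb : ∀ k, g (Sum.inr (Sum.inl k)) = 0 := by
      intro k
      have := congrArg (fun t => f (br F L (xv k) t)) hg
      simpa [map_sum, hxyz, hzr, hf, apply_ite f] using this
    have ht : g (Sum.inr (Sum.inr default)) = 0 := by
      simpa [hb, hz0] using hg
    rintro (i | j | k)
    · exact congrFun ha i
    · exact hb j
    · exact ht
  have hsp : ⊤ ≤ Submodule.span F (Set.range bv) := by
    rintro l -
    have hbm : ∀ k, bv k ∈ Submodule.span F (Set.range bv) := fun k =>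
      Submodule.subset_span ⟨k, rfl⟩
    obtain ⟨l0, h0, l1, h1, rfl⟩ := gr_decomp F l
    apply Submodule.add_mem
    · obtain ⟨a, rfl⟩ := hxspan l0 h0
      exact Submodule.sum_mem _ fun i _ => Submodule.smul_mem _ _ (hbm (Sum.inl i))
    · let s := ∑ j, f (br F L (xv j) l1) • yv j
      have hs : s ∈ gr F L 1 := Submodule.sum_mem _ fun i _ => Submodule.smul_mem _ _ (hyv i)
      have hd : l1 - s ∈ gr F L 1 := Submodule.sub_mem _ h1 hs
      obtain ⟨c, hc⟩ := hcen (l1 - s) (by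
        intro y
        obtain ⟨y0, hy0, y1, hy1, rfl⟩ := gr_decomp F y
        rw [map_add, b11 _ hd _ hy1, add_zero, br_skew10 hd hy0]
        obtain ⟨a, rfl⟩ := hxspan y0 hy0
        have : ∀ i, br F L (xv i) (l1 - s) = 0 := by
          intro i
          rw [hfb]
          simp [s, map_sum, hxyz, hf]
        simp [map_sum, LinearMap.sum_apply, -map_sub, this])
      have : l1 = s + c • z := by rw [hc]; abel
      rw [this]
      apply Submodule.add_mem
      · exact Submodule.sum_mem _ fun i _ => Submodule.smul_mem _ _ (hbm (Sum.inr (Sum.inl i)))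
      · exact Submodule.smul_mem _ _ (hbm (Sum.inr (Sum.inr ())))
  let B := Basis.mk hli hsp
  have hBb : ∀ k, B k = bv k := fun k => Basis.mk_apply hli hsp k
  have htot : finrank F L = m + (m + 1) := by
    rw [Module.finrank_eq_card_basis B]; simp
  have hadd : finrank F (gr F L 0) + finrank F (gr F L 1) = finrank F L :=
    Submodule.finrank_add_eq_of_isCompl SuperModule.isCompl_grade
  refine ⟨m, ?_, rfl, ?_, xv, yv, z, B, ?_, ?_, ?_, hxv, hyv, hz1, ?_, hxyz, ?_, ?_, ?_, ?_, ?_, ?_, ?_⟩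
  · by_contra hm
    have hm0 : m = 0 := by omega
    have hemp : IsEmpty (Fin m) := by rw [hm0]; infer_instance
    have hz' : z ∈ derivedSub F L := by
      rw [← hcd, hcz]; exact Submodule.mem_span_singleton_self z
    have : derivedSub F L = ⊥ := by
      rw [derivedSub, Submodule.span_eq_bot]
      rintro _ ⟨x, y, rfl⟩
      obtain ⟨x0, h0, x1, h1, rfl⟩ := gr_decomp F x
      obtain ⟨y0, k0, y1, k1, rfl⟩ := gr_decomp F y
      obtain ⟨a, rfl⟩ := hxspan x0 h0
      obtain ⟨b, rfl⟩ := hxspan y0 k0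
      simp [b11 x1 h1 y1 k1]
    rw [this] at hz'
    exact hz0 ((Submodule.mem_bot F).1 hz')
  · change finrank F (gr F L 0) + finrank F (gr F L 1) = finrank F L at hadd
    have : finrank F (gr F L 0) = m := rfl
    omega
  · intro i; rw [hBb]; rfl
  · intro i; rw [hBb]; rfl
  · rw [hBb]; rfl
  · intro i j; exact b00 _ (hxv i) _ (hxv j)
  · intro i j
    rw [br_skew10 (hyv i) (hxv j), hxyz]
    split_ifs with h1 h2 h2
    · rfl
    · exact absurd h1.symm h2
    · exact absurd h2.symm h1
    · simp
  · intro i j; exact b11 _ (hyv i) _ (hyv j)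
  · intro i; exact hzr _
  · intro i; exact hzl _
  · intro i; exact hzr _
  · intro i; exact hzl _
  · exact hzl _

theorem schur_of {F : Type u} {Fr : Type v} [Field F] [AddCommGroup Fr]
    [Module F Fr] [SuperModule F Fr] [LieSuperAlgebra F Fr]
    (R : Submodule F Fr) (a : ZMod 2) {J : Type w} [Fintype J] (s : J → Fr)
    (hs : ∀ i, s i ∈ R ⊓ derivedSub F Fr ⊓ gr F Fr a)
    (hspan : R ⊓ derivedSub F Fr ⊓ gr F Fr a ≤
      Submodule.span F (Set.range s) ⊔ bracketSub F Fr ⊤ R)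
    (ω : J → Fr →ₗ[F] F) (hω : ∀ i, bracketSub F Fr ⊤ R ≤ LinearMap.ker (ω i))
    (hoff : ∀ i j, i ≠ j → ω i (s j) = 0) (hdiag : ∀ i, ω i (s i) ≠ 0) :
    schurDim F Fr R a = Fintype.card J := by
  set I := bracketSub F Fr ⊤ R with hI
  have h1 : (R ⊓ derivedSub F Fr ⊓ gr F Fr a).map I.mkQ
      = Submodule.span F (Set.range (fun i => I.mkQ (s i))) := by
    apply le_antisymm
    · refine (Submodule.map_mono hspan).trans ?_
      rw [Submodule.map_sup, Submodule.map_span, ← Set.range_comp]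
      apply sup_le
      · exact le_refl _
      · rw [Submodule.mkQ_map_self]; exact bot_le
    · rw [Submodule.span_le]
      rintro _ ⟨i, rfl⟩
      exact Submodule.mem_map_of_mem (hs i)
  have hli : LinearIndependent F (fun i => I.mkQ (s i)) := by
    rw [Fintype.linearIndependent_iff]
    intro g hg i
    have := congrArg (I.liftQ (ω i) (hω i)) hg
    rw [map_sum, map_zero, Finset.sum_eq_single i] at this
    · simpa [hdiag i] using this
    · intro j _ hj
      simp [hoff i j hj.symm]
    · simp
  rw [schurDim, ← hI, h1, finrank_span_eq_card hli]

theorem derived_gr (F : Type u) (Fr : Type v) [Field F] [AddCommGroup Fr]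
    [Module F Fr] [SuperModule F Fr] [LieSuperAlgebra F Fr] :
    (∀ r ∈ derivedSub F Fr, r ∈ gr F Fr 0 → r ∈ Submodule.span F {t | ∃ u v,
      ((u ∈ gr F Fr 0 ∧ v ∈ gr F Fr 0) ∨ (u ∈ gr F Fr 1 ∧ v ∈ gr F Fr 1)) ∧ br F Fr u v = t}) ∧
    (∀ r ∈ derivedSub F Fr, r ∈ gr F Fr 1 → r ∈ Submodule.span F {t | ∃ u v,
      (u ∈ gr F Fr 0 ∧ v ∈ gr F Fr 1) ∧ br F Fr u v = t}) := by
  set T0 := Submodule.span F {t | ∃ u v,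
      ((u ∈ gr F Fr 0 ∧ v ∈ gr F Fr 0) ∨ (u ∈ gr F Fr 1 ∧ v ∈ gr F Fr 1)) ∧ br F Fr u v = t} with hT0
  set T1 := Submodule.span F {t | ∃ u v,
      (u ∈ gr F Fr 0 ∧ v ∈ gr F Fr 1) ∧ br F Fr u v = t} with hT1
  have h0 : T0 ≤ gr F Fr 0 := by
    rw [hT0, Submodule.span_le]
    rintro _ ⟨u, v, (⟨hu, hv⟩ | ⟨hu, hv⟩), rfl⟩
    · exact br_gr00 hu hv
    · exact br_gr11 hu hv
  have h1 : T1 ≤ gr F Fr 1 := by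
    rw [hT1, Submodule.span_le]
    rintro _ ⟨u, v, ⟨hu, hv⟩, rfl⟩
    exact br_gr01 hu hv
  have hd : derivedSub F Fr ≤ T0 ⊔ T1 := by
    rw [derivedSub, Submodule.span_le]
    rintro _ ⟨u, v, rfl⟩
    obtain ⟨u0, hu0, u1, hu1, rfl⟩ := gr_decomp F u
    obtain ⟨v0, hv0, v1, hv1, rfl⟩ := gr_decomp F v
    refine Submodule.mem_sup.2 ⟨br F Fr u0 v0 + br F Fr u1 v1, ?_,
      br F Fr u0 v1 - br F Fr v0 u1, ?_, ?_⟩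
    · exact Submodule.add_mem _ (Submodule.subset_span ⟨_, _, Or.inl ⟨hu0, hv0⟩, rfl⟩)
        (Submodule.subset_span ⟨_, _, Or.inr ⟨hu1, hv1⟩, rfl⟩)
    · exact Submodule.sub_mem _ (Submodule.subset_span ⟨_, _, ⟨hu0, hv1⟩, rfl⟩)
        (Submodule.subset_span ⟨_, _, ⟨hv0, hu1⟩, rfl⟩)
    · rw [br_skew01 hv0 hu1]
      simp only [map_add, LinearMap.add_apply]; abel
  constructor
  · intro r hr hr0
    obtain ⟨t0, ht0, t1, ht1, rfl⟩ := Submodule.mem_sup.1 (hd hr)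
    have : t1 = 0 := gr_disj (by simpa using Submodule.sub_mem _ hr0 (h0 ht0)) (h1 ht1)
    simpa [this] using ht0
  · intro r hr hr0
    obtain ⟨t0, ht0, t1, ht1, rfl⟩ := Submodule.mem_sup.1 (hd hr)
    have : t0 = 0 := gr_disj (h0 ht0) (by simpa using Submodule.sub_mem _ hr0 (h1 ht1))
    simpa [this] using ht1

/-- Data of a standard basis of `H_m`. -/
structure HB (F : Type u) (m : ℕ) (L : Type v) [Field F]
    [AddCommGroup L] [Module F L] [SuperModule F L] [LieSuperAlgebra F L] where
  B : Basis ((Fin m) ⊕ (Fin m) ⊕ Unit) F L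
  x : Fin m → L
  y : Fin m → L
  z : L
  Bx : ∀ i, B (Sum.inl i) = x i
  By : ∀ j, B (Sum.inr (Sum.inl j)) = y j
  Bz : B (Sum.inr (Sum.inr ())) = z
  hx : ∀ i, x i ∈ gr F L 0
  hy : ∀ i, y i ∈ gr F L 1
  hz : z ∈ gr F L 1
  xx : ∀ i j, br F L (x i) (x j) = 0
  xy : ∀ i j, br F L (x i) (y j) = if i = j then z else 0
  yx : ∀ i j, br F L (y i) (x j) = if i = j then -z else 0
  yy : ∀ i j, br F L (y i) (y j) = 0
  xz : ∀ i, br F L (x i) z = 0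
  zx : ∀ i, br F L z (x i) = 0
  yz : ∀ i, br F L (y i) z = 0
  zy : ∀ i, br F L z (y i) = 0
  zz : br F L z z = 0

namespace HB

variable {F : Type u} {m : ℕ} {L : Type v} [Field F]
    [AddCommGroup L] [Module F L] [SuperModule F L] [LieSuperAlgebra F L] (D : HB F m L)

/-- x-coordinate -/
noncomputable def ξ (i : Fin m) : L →ₗ[F] F := D.B.coord (Sum.inl i)
/-- y-coordinate -/
noncomputable def η (i : Fin m) : L →ₗ[F] F := D.B.coord (Sum.inr (Sum.inl i))
/-- z-coordinate -/
noncomputable def ζ : L →ₗ[F] F := D.B.coord (Sum.inr (Sum.inr ()))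

theorem ξx (i j) : D.ξ i (D.x j) = if i = j then 1 else 0 := by
  rw [← D.Bx, ξ]; simp [Finsupp.single_apply, eq_comm]
theorem ξy (i j) : D.ξ i (D.y j) = 0 := by
  rw [← D.By, ξ]; simp
theorem ξz (i) : D.ξ i D.z = 0 := by
  rw [← D.Bz, ξ]; simp
theorem ηx (i j) : D.η i (D.x j) = 0 := by
  rw [← D.Bx, η]; simp
theorem ηy (i j) : D.η i (D.y j) = if i = j then 1 else 0 := by
  rw [← D.By, η]; simp [Finsupp.single_apply, eq_comm]
theorem ηz (i) : D.η i D.z = 0 := by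
  rw [← D.Bz, η]; simp
theorem ζx (j) : D.ζ (D.x j) = 0 := by
  rw [← D.Bx, ζ]; simp
theorem ζy (j) : D.ζ (D.y j) = 0 := by
  rw [← D.By, ζ]; simp
theorem ζz : D.ζ D.z = 1 := by
  rw [← D.Bz, ζ]; simp

theorem expand (l : L) : l = ∑ i, D.ξ i l • D.x i + (∑ i, D.η i l • D.y i + D.ζ l • D.z) := by
  have := D.B.sum_repr l
  rw [Fintype.sum_sum_type, Fintype.sum_sum_type] at this
  simpa [ξ, η, ζ, D.Bx, D.By, D.Bz, eq_comm] using this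

theorem even_part (l : L) : ∑ i, D.ξ i l • D.x i ∈ gr F L 0 :=
  Submodule.sum_mem _ fun i _ => Submodule.smul_mem _ _ (D.hx i)

theorem odd_part (l : L) : ∑ i, D.η i l • D.y i + D.ζ l • D.z ∈ gr F L 1 :=
  Submodule.add_mem _ (Submodule.sum_mem _ fun i _ => Submodule.smul_mem _ _ (D.hy i))
    (Submodule.smul_mem _ _ D.hz)

theorem expand0 {l : L} (hl : l ∈ gr F L 0) : l = ∑ i, D.ξ i l • D.x i := by
  have h := D.expand l
  have : ∑ i, D.η i l • D.y i + D.ζ l • D.z = 0 := by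
    refine gr_disj ?_ (D.odd_part l)
    rw [← sub_eq_iff_eq_add'] at h
    rw [← h]; exact Submodule.sub_mem _ hl (D.even_part l)
  rw [this, add_zero] at h; exact h

theorem expand1 {l : L} (hl : l ∈ gr F L 1) : l = ∑ i, D.η i l • D.y i + D.ζ l • D.z := by
  have h := D.expand l
  have : ∑ i, D.ξ i l • D.x i = 0 := by
    refine gr_disj (D.even_part l) ?_
    rw [← sub_eq_iff_eq_add] at h
    rw [← h]; exact Submodule.sub_mem _ hl (D.odd_part l)
  rw [this, zero_add] at h; exact h

theorem ξ1 {l : L} (hl : l ∈ gr F L 1) (i) : D.ξ i l = 0 := by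
  rw [D.expand1 hl]; simp [D.ξy, D.ξz]
theorem η0 {l : L} (hl : l ∈ gr F L 0) (i) : D.η i l = 0 := by
  rw [D.expand0 hl]; simp [D.ηx]
theorem ζ0 {l : L} (hl : l ∈ gr F L 0) : D.ζ l = 0 := by
  rw [D.expand0 hl]; simp [D.ζx]

theorem br_formula (l l' : L) :
    br F L l l' = (∑ i, (D.ξ i l * D.η i l' - D.η i l * D.ξ i l')) • D.z := by
  conv_lhs => rw [D.expand l, D.expand l']
  simp only [map_add, LinearMap.add_apply, map_sum, LinearMap.sum_apply, map_smul,
    LinearMap.smul_apply, D.xx, D.xy, D.yx, D.yy, D.xz, D.zx, D.yz, D.zy, D.zz]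
  simp [Finset.sum_smul, add_smul, Finset.sum_add_distrib, smul_smul, sub_eq_add_neg, mul_comm, add_comm]

theorem ξbr (i l l') : D.ξ i (br F L l l') = 0 := by rw [D.br_formula]; simp [D.ξz]
theorem ηbr (i l l') : D.η i (br F L l l') = 0 := by rw [D.br_formula]; simp [D.ηz]
theorem ζbr (l l') : D.ζ (br F L l l') = ∑ i, (D.ξ i l * D.η i l' - D.η i l * D.ξ i l') := by
  rw [D.br_formula]; simp [D.ζz]

end HB

/-- bilinear form `f ⊗ g - g ⊗ f` -/
def antiC {F : Type u} {L : Type v} [Field F] [AddCommGroup L] [Module F L]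
    (f g : L →ₗ[F] F) : L →ₗ[F] L →ₗ[F] F :=
  LinearMap.mk₂ F (fun u v => f u * g v - g u * f v)
    (by intros; simp; ring) (by intros; simp; ring) (by intros; simp; ring) (by intros; simp; ring)

/-- bilinear form `f ⊗ g + g ⊗ f` -/
def symC {F : Type u} {L : Type v} [Field F] [AddCommGroup L] [Module F L]
    (f g : L →ₗ[F] F) : L →ₗ[F] L →ₗ[F] F :=
  LinearMap.mk₂ F (fun u v => f u * g v + g u * f v)
    (by intros; simp; ring) (by intros; simp; ring) (by intros; simp; ring) (by intros; simp; ring)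

theorem antiC_apply {F : Type u} {L : Type v} [Field F] [AddCommGroup L] [Module F L]
    (f g : L →ₗ[F] F) (u v) : antiC f g u v = f u * g v - g u * f v := rfl
theorem symC_apply {F : Type u} {L : Type v} [Field F] [AddCommGroup L] [Module F L]
    (f g : L →ₗ[F] F) (u v) : symC f g u v = f u * g v + g u * f v := rfl

namespace HB

variable {F : Type u} {m : ℕ} {L : Type v} [Field F]
    [AddCommGroup L] [Module F L] [SuperModule F L] [LieSuperAlgebra F L] (D : HB F m L)

theorem coc_xx (i j) : IsCocyc F L 0 (antiC (D.ξ i) (D.ξ j)) where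
  grade := by
    intro a b x y hx hy h
    rcases zmod2_cases a with rfl | rfl <;> rcases zmod2_cases b with rfl | rfl
    · simp at h
    · simp [antiC_apply, D.ξ1 hy]
    · simp [antiC_apply, D.ξ1 hx]
    · exact absurd (by decide) h
  skew := by
    intro a b x y hx hy
    rcases zmod2_cases a with rfl | rfl <;> rcases zmod2_cases b with rfl | rfl
    · simp [antiC_apply, sgn]; ring
    · simp [antiC_apply, D.ξ1 hy]
    · simp [antiC_apply, D.ξ1 hx]
    · simp [antiC_apply, D.ξ1 hx]
  jacobi := by
    intros; simp [antiC_apply, D.ξbr]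

theorem coc_yy (i j) : IsCocyc F L 0 (symC (D.η i) (D.η j)) where
  grade := by
    intro a b x y hx hy h
    rcases zmod2_cases a with rfl | rfl <;> rcases zmod2_cases b with rfl | rfl
    · simp at h
    · simp [symC_apply, D.η0 hx]
    · simp [symC_apply, D.η0 hy]
    · exact absurd (by decide) h
  skew := by
    intro a b x y hx hy
    rcases zmod2_cases a with rfl | rfl <;> rcases zmod2_cases b with rfl | rfl
    · simp [symC_apply, D.η0 hx]
    · simp [symC_apply, D.η0 hx]
    · simp [symC_apply, D.η0 hy]
    · simp [symC_apply, sgn]; ring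
  jacobi := by
    intros; simp [symC_apply, D.ηbr]

theorem coc_xy (i j) : IsCocyc F L 1 (antiC (D.ξ i) (D.η j)) where
  grade := by
    intro a b x y hx hy h
    rcases zmod2_cases a with rfl | rfl <;> rcases zmod2_cases b with rfl | rfl
    · simp [antiC_apply, D.η0 hx, D.η0 hy]
    · simp at h
    · simp at h
    · simp [antiC_apply, D.ξ1 hx, D.ξ1 hy]
  skew := by
    intro a b x y hx hy
    rcases zmod2_cases a with rfl | rfl <;> rcases zmod2_cases b with rfl | rfl
    · simp [antiC_apply, D.η0 hx, D.η0 hy]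
    · simp [antiC_apply, sgn]; ring
    · simp [antiC_apply, sgn]; ring
    · simp [antiC_apply, D.ξ1 hx, D.ξ1 hy]
  jacobi := by
    intros; simp [antiC_apply, D.ξbr, D.ηbr]

theorem coc_xz (D : HB F 1 L) : IsCocyc F L 1 (antiC (D.ξ 0) D.ζ) where
  grade := by
    intro a b x y hx hy h
    rcases zmod2_cases a with rfl | rfl <;> rcases zmod2_cases b with rfl | rfl
    · simp [antiC_apply, D.ζ0 hx, D.ζ0 hy]
    · simp at h
    · simp at h
    · simp [antiC_apply, D.ξ1 hx, D.ξ1 hy]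
  skew := by
    intro a b x y hx hy
    rcases zmod2_cases a with rfl | rfl <;> rcases zmod2_cases b with rfl | rfl
    · simp [antiC_apply, D.ζ0 hx, D.ζ0 hy]
    · simp [antiC_apply, sgn]; ring
    · simp [antiC_apply, sgn]; ring
    · simp [antiC_apply, D.ξ1 hx, D.ξ1 hy]
  jacobi := by
    intro a b d x y z hx hy hz
    simp only [antiC_apply, D.ξbr, D.ζbr, Finset.univ_unique, Finset.sum_singleton, Fin.default_eq_zero]
    rcases zmod2_cases a with rfl | rfl <;> rcases zmod2_cases b with rfl | rfl <;>
      rcases zmod2_cases d with rfl | rfl <;> simp [sgn]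
    · simp [D.η0 hx, D.η0 hy, D.η0 hz]
    · simp [D.η0 hx, D.η0 hy, D.ξ1 hz]; ring
    · simp [D.η0 hx, D.ξ1 hy, D.η0 hz]; ring
    · simp [D.ξ1 hy, D.ξ1 hz]
    · simp [D.ξ1 hx, D.η0 hy, D.η0 hz]; ring
    · simp [D.ξ1 hx, D.ξ1 hz]
    · simp [D.ξ1 hx, D.ξ1 hy]
    · simp [D.ξ1 hx, D.ξ1 hy, D.ξ1 hz]

end HB

theorem br_mem_right {F : Type u} {Fr : Type v} [Field F] [AddCommGroup Fr]
    [Module F Fr] [SuperModule F Fr] [LieSuperAlgebra F Fr]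
    {R : Submodule F Fr} (u : Fr) {r : Fr} (hr : r ∈ R) : br F Fr u r ∈ bracketSub F Fr ⊤ R :=
  Submodule.subset_span ⟨u, trivial, r, hr, rfl⟩

theorem br_mem_left {F : Type u} {Fr : Type v} {L : Type w} [Field F] [AddCommGroup Fr]
    [Module F Fr] [SuperModule F Fr] [LieSuperAlgebra F Fr]
    [AddCommGroup L] [Module F L] [SuperModule F L] [LieSuperAlgebra F L]
    (φ : LieSuperHom F Fr L) (u : Fr) {r : Fr} (hr : φ.toLinearMap r = 0) :
    br F Fr r u ∈ bracketSub F Fr ⊤ (LinearMap.ker φ.toLinearMap) := by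
  obtain ⟨r0, h0, r1, h1, rfl⟩ := gr_decomp F r
  obtain ⟨u0, k0, u1, k1, rfl⟩ := gr_decomp F u
  rw [map_add] at hr
  have e0 : φ.toLinearMap r0 = 0 := by
    refine gr_disj (φ.map_grade 0 _ h0) ?_
    rw [eq_neg_of_add_eq_zero_left hr]
    exact Submodule.neg_mem _ (φ.map_grade 1 _ h1)
  have e1 : φ.toLinearMap r1 = 0 := by simpa [e0] using hr
  simp only [map_add, LinearMap.add_apply]
  rw [br_skew00 h0 k0, br_skew01 h0 k1, br_skew10 h1 k0, br_skew11 h1 k1]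
  have m0 : ∀ v, br F Fr v r0 ∈ bracketSub F Fr ⊤ (LinearMap.ker φ.toLinearMap) :=
    fun v => br_mem_right v e0
  have m1 : ∀ v, br F Fr v r1 ∈ bracketSub F Fr ⊤ (LinearMap.ker φ.toLinearMap) :=
    fun v => br_mem_right v e1
  exact Submodule.add_mem _ (Submodule.add_mem _ (Submodule.neg_mem _ (m0 _))
    (Submodule.neg_mem _ (m1 _))) (Submodule.add_mem _ (Submodule.neg_mem _ (m0 _)) (m1 _))

theorem br_mod {F : Type u} {Fr : Type v} {L : Type w} [Field F] [AddCommGroup Fr]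
    [Module F Fr] [SuperModule F Fr] [LieSuperAlgebra F Fr]
    [AddCommGroup L] [Module F L] [SuperModule F L] [LieSuperAlgebra F L]
    (φ : LieSuperHom F Fr L) {T : Submodule F Fr}
    (hT : bracketSub F Fr ⊤ (LinearMap.ker φ.toLinearMap) ≤ T) {u v u' v' : Fr}
    (hu : φ.toLinearMap u = φ.toLinearMap u') (hv : φ.toLinearMap v = φ.toLinearMap v')
    (h : br F Fr u' v' ∈ T) : br F Fr u v ∈ T := by
  have e : br F Fr u v = br F Fr (u - u') v + br F Fr u' (v - v') + br F Fr u' v' := by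
    simp only [map_sub, LinearMap.sub_apply]; abel
  rw [e]
  refine Submodule.add_mem _ (Submodule.add_mem _ (hT ?_) (hT ?_)) h
  · exact br_mem_left φ _ (by rw [map_sub, hu, sub_self])
  · exact br_mem_right _ (by rw [LinearMap.mem_ker, map_sub, hv, sub_self])

theorem lift_gr {F : Type u} {Fr : Type v} {L : Type w} [Field F] [AddCommGroup Fr]
    [Module F Fr] [SuperModule F Fr] [LieSuperAlgebra F Fr]
    [AddCommGroup L] [Module F L] [SuperModule F L] [LieSuperAlgebra F L]
    (φ : LieSuperHom F Fr L) (hφ : Function.Surjective φ.toLinearMap) :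
    (∀ l ∈ gr F L 0, ∃ u ∈ gr F Fr 0, φ.toLinearMap u = l) ∧
    (∀ l ∈ gr F L 1, ∃ u ∈ gr F Fr 1, φ.toLinearMap u = l) := by
  constructor
  · intro l hl
    obtain ⟨u, rfl⟩ := hφ l
    obtain ⟨u0, h0, u1, h1, rfl⟩ := gr_decomp F u
    refine ⟨u0, h0, ?_⟩
    rw [map_add] at hl ⊢
    have : φ.toLinearMap u1 = 0 := gr_disj
      (by simpa using Submodule.sub_mem _ hl (φ.map_grade 0 _ h0)) (φ.map_grade 1 _ h1)
    rw [this, add_zero]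
  · intro l hl
    obtain ⟨u, rfl⟩ := hφ l
    obtain ⟨u0, h0, u1, h1, rfl⟩ := gr_decomp F u
    refine ⟨u1, h1, ?_⟩
    rw [map_add] at hl ⊢
    have : φ.toLinearMap u0 = 0 := gr_disj (φ.map_grade 0 _ h0)
      (by simpa using Submodule.sub_mem _ hl (φ.map_grade 1 _ h1))
    rw [this, zero_add]

/-- Data of homogeneous lifts. -/
structure HL {F : Type u} {m : ℕ} {L : Type v} {Fr : Type w} [Field F]
    [AddCommGroup L] [Module F L] [SuperModule F L] [LieSuperAlgebra F L]
    [AddCommGroup Fr] [Module F Fr] [SuperModule F Fr] [LieSuperAlgebra F Fr]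
    (D : HB F m L) (φ : LieSuperHom F Fr L) where
  X : Fin m → Fr
  Y : Fin m → Fr
  o : Fin m
  hX : ∀ i, X i ∈ gr F Fr 0
  hY : ∀ i, Y i ∈ gr F Fr 1
  φX : ∀ i, φ.toLinearMap (X i) = D.x i
  φY : ∀ i, φ.toLinearMap (Y i) = D.y i

namespace HL

variable {F : Type u} {m : ℕ} {L : Type v} {Fr : Type w} [Field F]
    [AddCommGroup L] [Module F L] [SuperModule F L] [LieSuperAlgebra F L]
    [AddCommGroup Fr] [Module F Fr] [SuperModule F Fr] [LieSuperAlgebra F Fr]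
    {D : HB F m L} {φ : LieSuperHom F Fr L} (E : HL D φ)

/-- lift of z -/
def Z : Fr := br F Fr (E.X E.o) (E.Y E.o)

theorem hZ : E.Z ∈ gr F Fr 1 := br_gr01 (E.hX _) (E.hY _)

theorem φXY (i j) : φ.toLinearMap (br F Fr (E.X i) (E.Y j)) = if i = j then D.z else 0 := by
  rw [φ.map_bracket, E.φX, E.φY, D.xy]

theorem φZ : φ.toLinearMap E.Z = D.z := by
  rw [Z, E.φXY]; simp

theorem YZ (h2 : (2 : F) ≠ 0) (i) :
    br F Fr (E.Y i) E.Z ∈ bracketSub F Fr ⊤ (LinearMap.ker φ.toLinearMap) := by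
  apply br_mod φ le_rfl (u' := E.Y i) (v' := br F Fr (E.X i) (E.Y i)) rfl
  · rw [E.φZ, E.φXY]; simp
  · have j := LieSuperAlgebra.jacobi (F := F) 0 1 1 _ _ _ (E.hX i) (E.hY i) (E.hY i)
    have k := br_skew10 (E.hY i) (E.hX i)
    have hm : br F Fr (E.X i) (br F Fr (E.Y i) (E.Y i)) ∈
        bracketSub F Fr ⊤ (LinearMap.ker φ.toLinearMap) := by
      apply br_mem_right
      rw [LinearMap.mem_ker, φ.map_bracket, E.φY, D.yy]
    simp only [sgn, br] at j k hm ⊢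
    rw [k] at j
    simp at j
    have e : LieSuperAlgebra.bracket (F := F) (E.Y i) (LieSuperAlgebra.bracket (F := F) (E.X i) (E.Y i))
        = (2 : F)⁻¹ • LieSuperAlgebra.bracket (F := F) (E.X i)
          (LieSuperAlgebra.bracket (F := F) (E.Y i) (E.Y i)) := by
      rw [eq_inv_smul_iff₀ h2, two_smul]
      rw [add_assoc, add_eq_zero_iff_eq_neg] at j
      rw [j]; abel
    rw [e]
    exact Submodule.smul_mem _ _ hm

theorem ZZ : br F Fr E.Z E.Z ∈ bracketSub F Fr ⊤ (LinearMap.ker φ.toLinearMap) := by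
  have j := LieSuperAlgebra.jacobi (F := F) 1 0 1 _ _ _ E.hZ (E.hX E.o) (E.hY E.o)
  have h1 : br F Fr (E.X E.o) (br F Fr (E.Y E.o) E.Z) ∈
      bracketSub F Fr ⊤ (LinearMap.ker φ.toLinearMap) := by
    apply br_mem_right
    rw [LinearMap.mem_ker, φ.map_bracket, E.φY, E.φZ, D.yz]
  have h3 : br F Fr (E.Y E.o) (br F Fr E.Z (E.X E.o)) ∈
      bracketSub F Fr ⊤ (LinearMap.ker φ.toLinearMap) := by
    apply br_mem_right
    rw [LinearMap.mem_ker, φ.map_bracket, E.φX, E.φZ, D.zx]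
  have e : br F Fr E.Z E.Z = br F Fr (E.X E.o) (br F Fr (E.Y E.o) E.Z)
      + br F Fr (E.Y E.o) (br F Fr E.Z (E.X E.o)) := by
    change br F Fr E.Z (br F Fr (E.X E.o) (E.Y E.o)) = _
    simp only [sgn, br] at j ⊢
    simp at j
    rw [add_assoc, neg_add_eq_zero] at j
    exact j
  rw [e]; exact Submodule.add_mem _ h1 h3

theorem XZ {i k : Fin m} (hik : i ≠ k) :
    br F Fr (E.X i) E.Z ∈ bracketSub F Fr ⊤ (LinearMap.ker φ.toLinearMap) := by
  apply br_mod φ le_rfl (u' := E.X i) (v' := br F Fr (E.X k) (E.Y k)) rfl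
  · rw [E.φZ, E.φXY]; simp
  · have j := LieSuperAlgebra.jacobi (F := F) 0 0 1 _ _ _ (E.hX i) (E.hX k) (E.hY k)
    have h1 : br F Fr (E.X k) (br F Fr (E.Y k) (E.X i)) ∈
        bracketSub F Fr ⊤ (LinearMap.ker φ.toLinearMap) := by
      apply br_mem_right
      rw [LinearMap.mem_ker, φ.map_bracket, E.φY, E.φX, D.yx, if_neg hik.symm]
    have h3 : br F Fr (E.Y k) (br F Fr (E.X i) (E.X k)) ∈
        bracketSub F Fr ⊤ (LinearMap.ker φ.toLinearMap) := by
      apply br_mem_right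
      rw [LinearMap.mem_ker, φ.map_bracket, E.φX, E.φX, D.xx]
    have e : br F Fr (E.X i) (br F Fr (E.X k) (E.Y k)) = -(br F Fr (E.X k) (br F Fr (E.Y k) (E.X i))
        + br F Fr (E.Y k) (br F Fr (E.X i) (E.X k))) := by
      simp only [sgn, br] at j ⊢
      simp at j
      rw [add_assoc, add_eq_zero_iff_eq_neg] at j
      exact j
    rw [e]; exact Submodule.neg_mem _ (Submodule.add_mem _ h1 h3)

theorem dec0 {u : Fr} (hu : u ∈ gr F Fr 0) :
    ∃ a : Fin m → F, φ.toLinearMap u = φ.toLinearMap (∑ i, a i • E.X i) := by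
  refine ⟨fun i => D.ξ i (φ.toLinearMap u), ?_⟩
  conv_lhs => rw [D.expand0 (φ.map_grade 0 _ hu)]
  simp [E.φX]

theorem dec1 {u : Fr} (hu : u ∈ gr F Fr 1) :
    ∃ (a : Fin m → F) (t : F),
      φ.toLinearMap u = φ.toLinearMap (∑ i, a i • E.Y i + t • E.Z) := by
  refine ⟨fun i => D.η i (φ.toLinearMap u), D.ζ (φ.toLinearMap u), ?_⟩
  conv_lhs => rw [D.expand1 (φ.map_grade 1 _ hu)]
  simp [E.φY, E.φZ]

theorem mem00 {T : Submodule F Fr}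
    (hT : bracketSub F Fr ⊤ (LinearMap.ker φ.toLinearMap) ≤ T)
    (h : ∀ i j, br F Fr (E.X i) (E.X j) ∈ T) {u v : Fr} (hu : u ∈ gr F Fr 0)
    (hv : v ∈ gr F Fr 0) : br F Fr u v ∈ T := by
  obtain ⟨a, ha⟩ := E.dec0 hu
  obtain ⟨b, hb⟩ := E.dec0 hv
  apply br_mod φ hT ha hb
  simp only [map_sum, LinearMap.sum_apply, map_smul, LinearMap.smul_apply]
  exact Submodule.sum_mem _ fun i _ => Submodule.smul_mem _ _
    (Submodule.sum_mem _ fun j _ => Submodule.smul_mem _ _ (h _ _))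

theorem mem11 (h2 : (2 : F) ≠ 0) {T : Submodule F Fr}
    (hT : bracketSub F Fr ⊤ (LinearMap.ker φ.toLinearMap) ≤ T)
    (h : ∀ i j, br F Fr (E.Y i) (E.Y j) ∈ T) {u v : Fr} (hu : u ∈ gr F Fr 1)
    (hv : v ∈ gr F Fr 1) : br F Fr u v ∈ T := by
  obtain ⟨a, s, ha⟩ := E.dec1 hu
  obtain ⟨b, t, hb⟩ := E.dec1 hv
  apply br_mod φ hT ha hb
  have hYZ : ∀ i, br F Fr (E.Y i) E.Z ∈ T := fun i => hT (E.YZ h2 i)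
  have hZY : ∀ i, br F Fr E.Z (E.Y i) ∈ T := fun i => by
    rw [br_skew11 E.hZ (E.hY i)]; exact hYZ i
  have hZZ : br F Fr E.Z E.Z ∈ T := hT E.ZZ
  simp only [map_add, LinearMap.add_apply, map_sum, LinearMap.sum_apply, map_smul,
    LinearMap.smul_apply]
  refine Submodule.add_mem _ ?_ (Submodule.smul_mem _ _ (Submodule.add_mem _
    (Submodule.sum_mem _ fun i _ => Submodule.smul_mem _ _ (hYZ _)) (Submodule.smul_mem _ _ hZZ)))
  refine Submodule.sum_mem _ fun i _ => Submodule.smul_mem _ _ (Submodule.add_mem _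
    (Submodule.sum_mem _ fun j _ => Submodule.smul_mem _ _ (h _ _))
    (Submodule.smul_mem _ _ (hZY _)))

theorem mem01 {T : Submodule F Fr}
    (hT : bracketSub F Fr ⊤ (LinearMap.ker φ.toLinearMap) ≤ T)
    (h : ∀ i j, br F Fr (E.X i) (E.Y j) ∈ T) (h' : ∀ i, br F Fr (E.X i) E.Z ∈ T)
    {u v : Fr} (hu : u ∈ gr F Fr 0)
    (hv : v ∈ gr F Fr 1) : br F Fr u v ∈ T := by
  obtain ⟨a, ha⟩ := E.dec0 hu
  obtain ⟨b, t, hb⟩ := E.dec1 hv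
  apply br_mod φ hT ha hb
  simp only [map_add, LinearMap.add_apply, map_sum, LinearMap.sum_apply, map_smul,
    LinearMap.smul_apply]
  refine Submodule.add_mem _ ?_ ?_
  all_goals first
    | exact Submodule.sum_mem _ fun i _ => Submodule.smul_mem _ _
        (Submodule.sum_mem _ fun j _ => Submodule.smul_mem _ _ (h _ _))
    | exact Submodule.sum_mem _ fun i _ => Submodule.smul_mem _ _ (Submodule.smul_mem _ _ (h' _))
    | exact Submodule.smul_mem _ _ (Submodule.sum_mem _ fun i _ => Submodule.smul_mem _ _ (h' _))

end HL

theorem br_ker_le {F : Type u} {Fr : Type v} {L : Type w} [Field F] [AddCommGroup Fr]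
    [Module F Fr] [SuperModule F Fr] [LieSuperAlgebra F Fr]
    [AddCommGroup L] [Module F L] [SuperModule F L] [LieSuperAlgebra F L]
    (φ : LieSuperHom F Fr L) (ω : Fr →ₗ[F] F) (c : L →ₗ[F] L →ₗ[F] F)
    (h : ∀ u v, ω (br F Fr u v) = c (φ.toLinearMap u) (φ.toLinearMap v)) :
    bracketSub F Fr ⊤ (LinearMap.ker φ.toLinearMap) ≤ LinearMap.ker ω := by
  rw [bracketSub, Submodule.span_le]
  rintro _ ⟨u, -, r, hr, rfl⟩
  rw [LinearMap.mem_ker] at hr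
  simp only [SetLike.mem_coe, LinearMap.mem_ker, h, hr, map_zero]

theorem br_le_ker {F : Type u} {Fr : Type v} {L : Type w} [Field F] [AddCommGroup Fr]
    [Module F Fr] [SuperModule F Fr] [LieSuperAlgebra F Fr]
    [AddCommGroup L] [Module F L] [SuperModule F L] [LieSuperAlgebra F L]
    (φ : LieSuperHom F Fr L) :
    bracketSub F Fr ⊤ (LinearMap.ker φ.toLinearMap) ≤ LinearMap.ker φ.toLinearMap := by
  conv_lhs => rw [bracketSub]
  rw [Submodule.span_le]
  rintro _ ⟨u, -, r, hr, rfl⟩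
  rw [LinearMap.mem_ker] at hr
  simp only [SetLike.mem_coe, LinearMap.mem_ker, φ.map_bracket, hr, map_zero]

section final

variable {F : Type u} {X : Type v} {deg : X → ZMod 2} {Fr : Type w} [Field F]
    [AddCommGroup Fr] [Module F Fr] [SuperModule F Fr] [LieSuperAlgebra F Fr]
    {ι : X → Fr}
    {L : Type x} [AddCommGroup L] [Module F L] [SuperModule F L]
    [LieSuperAlgebra F L] [FiniteDimensional F L] {φ : LieSuperHom F Fr L} {m : ℕ}

theorem schur_even (h2 : (2 : F) ≠ 0) (hF : IsFreeLSA F X deg Fr ι)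
    (D : HB F m L) (E : HL D φ) : schurDim F Fr (LinearMap.ker φ.toLinearMap) 0 = m ^ 2 := by
  let c : Fin m × Fin m → L →ₗ[F] L →ₗ[F] F := fun p =>
    if p.1 < p.2 then antiC (D.ξ p.1) (D.ξ p.2) else symC (D.η p.1) (D.η p.2)
  have hc : ∀ p, IsCocyc F L 0 (c p) := by
    intro p
    by_cases h : p.1 < p.2
    · simp only [c, if_pos h]; exact D.coc_xx _ _
    · simp only [c, if_neg h]; exact D.coc_yy _ _
  choose ω hω using fun p => exists_omega hF φ 0 (c p) (hc p)
  let s : Fin m × Fin m → Fr := fun p =>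
    if p.1 < p.2 then br F Fr (E.X p.1) (E.X p.2) else br F Fr (E.Y p.1) (E.Y p.2)
  have hlt : ∀ i j, i < j → s (i, j) = br F Fr (E.X i) (E.X j) := fun i j h => by simp [s, h]
  have hge : ∀ i j, ¬ i < j → s (i, j) = br F Fr (E.Y i) (E.Y j) := fun i j h => by
    simp only [s, if_neg h]
  rw [schur_of (LinearMap.ker φ.toLinearMap) 0 s ?_ ?_ ω ?_ ?_ ?_]
  · simp [pow_two]
  · rintro ⟨i, j⟩
    by_cases h : i < j
    · rw [hlt _ _ h]
      refine ⟨⟨?_, Submodule.subset_span ⟨_, _, rfl⟩⟩, br_gr00 (E.hX _) (E.hX _)⟩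
      simp only [SetLike.mem_coe, LinearMap.mem_ker, φ.map_bracket, E.φX, D.xx]
    · rw [hge _ _ h]
      refine ⟨⟨?_, Submodule.subset_span ⟨_, _, rfl⟩⟩, br_gr11 (E.hY _) (E.hY _)⟩
      simp only [SetLike.mem_coe, LinearMap.mem_ker, φ.map_bracket, E.φY, D.yy]
  · rintro r ⟨⟨-, hr⟩, hr0⟩
    have := (derived_gr F Fr).1 r hr hr0
    refine Submodule.span_le.2 ?_ this
    set T := Submodule.span F (Set.range s) ⊔ bracketSub F Fr ⊤ (LinearMap.ker φ.toLinearMap)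
    have hsT : ∀ p, s p ∈ T := fun p => Submodule.mem_sup_left (Submodule.subset_span ⟨p, rfl⟩)
    rintro _ ⟨u, v, (⟨hu, hv⟩ | ⟨hu, hv⟩), rfl⟩
    · refine E.mem00 le_sup_right (fun i j => ?_) hu hv
      rcases lt_trichotomy i j with h | h | h
      · rw [← hlt _ _ h]; exact hsT _
      · subst h
        have h0 := br_skew00 (E.hX i) (E.hX i)
        have : br F Fr (E.X i) (E.X i) = 0 := by
          rw [eq_neg_iff_add_eq_zero, ← two_smul F, smul_eq_zero] at h0
          exact h0.resolve_left h2
        rw [this]; exact Submodule.zero_mem _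
      · rw [br_skew00 (E.hX i) (E.hX j), ← hlt _ _ h]
        exact Submodule.neg_mem _ (hsT _)
    · refine E.mem11 h2 le_sup_right (fun i j => ?_) hu hv
      by_cases h : i < j
      · rw [br_skew11 (E.hY i) (E.hY j), ← hge _ _ h.asymm]; exact hsT _
      · rw [← hge _ _ h]; exact hsT _
  · intro p; exact br_ker_le φ _ _ (hω p)
  · rintro ⟨i, j⟩ ⟨k, l⟩ hne
    by_cases h : i < j <;> by_cases h' : k < l
    · rw [hlt _ _ h', hω]
      simp only [c, if_pos h, antiC_apply, E.φX, D.ξx]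
      have : ¬ (i = k ∧ j = l) := by rintro ⟨rfl, rfl⟩; exact hne rfl
      have : ¬ (j = k ∧ i = l) := by rintro ⟨rfl, rfl⟩; exact h.asymm h'
      split_ifs <;> simp_all
    · rw [hge _ _ h', hω]
      simp [c, if_pos h, antiC_apply, E.φY, D.ξy]
    · rw [hlt _ _ h', hω]
      simp [c, if_neg h, symC_apply, E.φX, D.ηx]
    · rw [hge _ _ h', hω]
      simp only [c, if_neg h, symC_apply, E.φY, D.ηy]
      have : ¬ (i = k ∧ j = l) := by rintro ⟨rfl, rfl⟩; exact hne rfl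
      have : ¬ (j = k ∧ i = l) := by
        rintro ⟨rfl, rfl⟩
        have : i = j := le_antisymm (not_lt.1 h') (not_lt.1 h)
        subst this; exact hne rfl
      split_ifs <;> simp_all
  · rintro ⟨i, j⟩
    by_cases h : i < j
    · rw [hlt _ _ h, hω]
      simp [c, if_pos h, antiC_apply, E.φX, D.ξx, h.ne, h.ne']
    · rw [hge _ _ h, hω]
      simp only [c, if_neg h, symC_apply, E.φY, D.ηy]
      by_cases hij : i = j
      · subst hij; simpa [one_add_one_eq_two] using h2
      · simp [hij, Ne.symm hij]

/-- common part of the odd computation -/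
theorem odd_span (E : HL (D := (D : HB F m L)) φ) {J : Type y} (s : J → Fr)
    (h1 : ∀ i j, ¬ (i = E.o ∧ j = E.o) →
      br F Fr (E.X i) (E.Y j) - (if i = j then E.Z else 0) ∈ Submodule.span F (Set.range s) ⊔
        bracketSub F Fr ⊤ (LinearMap.ker φ.toLinearMap))
    (h2 : ∀ i, br F Fr (E.X i) E.Z ∈ Submodule.span F (Set.range s) ⊔
        bracketSub F Fr ⊤ (LinearMap.ker φ.toLinearMap)) :
    LinearMap.ker φ.toLinearMap ⊓ derivedSub F Fr ⊓ gr F Fr 1 ≤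
      Submodule.span F (Set.range s) ⊔ bracketSub F Fr ⊤ (LinearMap.ker φ.toLinearMap) := by
  set T := Submodule.span F (Set.range s) ⊔ bracketSub F Fr ⊤ (LinearMap.ker φ.toLinearMap)
  let P : Fr →ₗ[F] Fr := LinearMap.id - (D.ζ ∘ₗ φ.toLinearMap).smulRight E.Z
  have hP : ∀ r, P r = r - D.ζ (φ.toLinearMap r) • E.Z := fun r => rfl
  rintro r ⟨⟨hk, hr⟩, hr1⟩
  have := (derived_gr F Fr).2 r hr hr1
  have key : r ∈ T.comap P := by
    refine Submodule.span_le.2 ?_ this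
    rintro _ ⟨u, v, ⟨hu, hv⟩, rfl⟩
    refine E.mem01 ?_ (fun i j => ?_) (fun i => ?_) hu hv
    · intro t ht
      have h0 : φ.toLinearMap t = 0 := br_le_ker φ ht
      rw [Submodule.mem_comap, hP, h0, map_zero, zero_smul, sub_zero]
      exact Submodule.mem_sup_right ht
    · rw [Submodule.mem_comap, hP, E.φXY]
      by_cases hij : i = E.o ∧ j = E.o
      · obtain ⟨rfl, rfl⟩ := hij
        simp only [if_true, D.ζz, one_smul]
        rw [HL.Z, sub_self]; exact Submodule.zero_mem _
      · convert h1 i j hij using 2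
        split_ifs <;> simp [D.ζz]
    · rw [Submodule.mem_comap, hP, φ.map_bracket, E.φX, E.φZ, D.xz, map_zero, zero_smul, sub_zero]
      exact h2 i
  have h0 : φ.toLinearMap r = 0 := hk
  rw [Submodule.mem_comap, hP, h0, map_zero, zero_smul, sub_zero] at key
  exact key

theorem schur_odd (hF : IsFreeLSA F X deg Fr ι) (hm : 2 ≤ m)
    (D : HB F m L) (E : HL D φ) :
    schurDim F Fr (LinearMap.ker φ.toLinearMap) 1 = m ^ 2 - 1 := by
  classical
  let J := {p : Fin m × Fin m // p ≠ (E.o, E.o)}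
  choose ω hω using fun p : J => exists_omega hF φ 1 _ (D.coc_xy p.1.1 p.1.2)
  let s : J → Fr := fun p =>
    br F Fr (E.X p.1.1) (E.Y p.1.2) - (if p.1.1 = p.1.2 then E.Z else 0)
  have hωs : ∀ p q : J, ω p (s q) = if p = q then 1 else 0 := by
    rintro ⟨⟨i, j⟩, hp⟩ ⟨⟨k, l⟩, hq⟩
    have hZ : ω ⟨(i, j), hp⟩ E.Z = 0 := by
      rw [HL.Z, hω]
      simp only [antiC_apply, E.φX, E.φY, D.ξx, D.ξy, D.ηx, D.ηy]
      have : ¬ (i = E.o ∧ j = E.o) := by rintro ⟨h, h'⟩; exact hp (by rw [h, h'])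
      split_ifs <;> simp_all
    have : ω ⟨(i, j), hp⟩ (if k = l then E.Z else 0) = 0 := by
      split_ifs <;> simp [hZ]
    simp only [s, map_sub, this, hω]
    simp only [antiC_apply, E.φX, E.φY, D.ξx, D.ξy, D.ηx, D.ηy]
    have hiff : ((⟨(i, j), hp⟩ : J) = ⟨(k, l), hq⟩) ↔ (i = k ∧ j = l) := by
      rw [Subtype.ext_iff]; exact Prod.mk_inj
    simp only [hiff]
    clear hZ this
    split_ifs <;> simp_all
  rw [schur_of (LinearMap.ker φ.toLinearMap) 1 s ?_ ?_ ω ?_ ?_ ?_]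
  · simp [J, Fintype.card_subtype_compl, pow_two]
  · rintro ⟨⟨i, j⟩, hp⟩
    refine ⟨⟨?_, ?_⟩, ?_⟩
    · simp only [SetLike.mem_coe, LinearMap.mem_ker, s, map_sub, E.φXY]
      split_ifs <;> simp [E.φZ]
    · refine Submodule.sub_mem (derivedSub F Fr) (Submodule.subset_span ⟨_, _, rfl⟩) ?_
      split_ifs
      · exact Submodule.subset_span ⟨_, _, rfl⟩
      · exact Submodule.zero_mem _
    · apply Submodule.sub_mem _ (br_gr01 (E.hX _) (E.hY _))
      split_ifs
      · exact E.hZ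
      · exact Submodule.zero_mem _
  · apply odd_span E
    · intro i j hij
      exact Submodule.mem_sup_left (Submodule.subset_span
        ⟨⟨(i, j), fun h => hij (by simpa using h)⟩, rfl⟩)
    · intro i
      have : Nontrivial (Fin m) := Fin.nontrivial_iff_two_le.2 hm
      obtain ⟨k, hk⟩ := exists_ne i
      exact Submodule.mem_sup_right (E.XZ hk.symm)
  · intro p; exact br_ker_le φ _ _ (hω p)
  · intro p q h; rw [hωs, if_neg h]
  · intro p; rw [hωs, if_pos rfl]; exact one_ne_zero

theorem schur_odd1 (hF : IsFreeLSA F X deg Fr ι)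
    (D : HB F 1 L) (E : HL D φ) :
    schurDim F Fr (LinearMap.ker φ.toLinearMap) 1 = 1 := by
  obtain ⟨ω, hω⟩ := exists_omega hF φ 1 _ D.coc_xz
  rw [schur_of (LinearMap.ker φ.toLinearMap) 1 (fun _ : Unit => br F Fr (E.X 0) E.Z) ?_ ?_
    (fun _ => ω) ?_ ?_ ?_]
  · simp
  · intro _
    refine ⟨⟨?_, Submodule.subset_span ⟨_, _, rfl⟩⟩, br_gr01 (E.hX _) E.hZ⟩
    simp only [SetLike.mem_coe, LinearMap.mem_ker, φ.map_bracket, E.φX, E.φZ, D.xz]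
  · apply odd_span E
    · intro i j hij
      exact absurd ⟨Subsingleton.elim _ _, Subsingleton.elim _ _⟩ hij
    · intro i
      rw [Subsingleton.elim i 0]
      exact Submodule.mem_sup_left (Submodule.subset_span ⟨(), rfl⟩)
  · intro _; exact br_ker_le φ _ _ hω
  · intro i j h; exact absurd (Subsingleton.elim _ _) h
  · intro _
    rw [hω]
    simp [antiC_apply, E.φX, E.φZ, D.ξx, D.ζz, D.ξz]

end final

theorem stmt_13 (F : Type*) [Field F] (hchar2 : ringChar F ≠ 2) (hchar3 : ringChar F ≠ 3)
    (L : Type*) [AddCommGroup L] [Module F L] [SuperModule F L] [LieSuperAlgebra F L] [FiniteDimensional F L]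
    (hH : IsHeisenbergOdd F L) :
    ∃ m : ℕ, 1 ≤ m ∧ finrank F (gr F L 0) = m ∧ finrank F (gr F L 1) = m + 1 ∧
      IsHmOdd F m L ∧
      ∀ (X : Type*) (deg : X → ZMod 2)
        (Fr : Type*) [AddCommGroup Fr] [Module F Fr] [SuperModule F Fr]
        [LieSuperAlgebra F Fr] (ι : X → Fr), IsFreeLSA F X deg Fr ι →
        ∀ φ : LieSuperHom F Fr L, Function.Surjective φ.toLinearMap →
          ((2 ≤ m →
              schurDim F Fr (LinearMap.ker φ.toLinearMap) 0 = m ^ 2 ∧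
              schurDim F Fr (LinearMap.ker φ.toLinearMap) 1 = m ^ 2 - 1) ∧
            (m = 1 →
              schurDim F Fr (LinearMap.ker φ.toLinearMap) 0 = 1 ∧
              schurDim F Fr (LinearMap.ker φ.toLinearMap) 1 = 1)) := by
  have h2 : (2 : F) ≠ 0 := Ring.two_ne_zero hchar2
  obtain ⟨m, hm, h0, h1, hO⟩ := heis_class F L hH
  refine ⟨m, hm, h0, h1, hO, ?_⟩
  intro X deg Fr _ _ _ _ ι hF φ hφ
  obtain ⟨xv, yv, zv, B, a1, a2, a3, a4, a5, a6, a7, a8, a9, a10, a11, a12, a13, a14, a15⟩ := hO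
  let D : HB F m L := ⟨B, xv, yv, zv, a1, a2, a3, a4, a5, a6, a7, a8, a9, a10, a11, a12, a13,
    a14, a15⟩
  choose Xv hX hφX using fun i => (lift_gr φ hφ).1 (xv i) (a4 i)
  choose Yv hY hφY using fun i => (lift_gr φ hφ).2 (yv i) (a5 i)
  let E : HL D φ := ⟨Xv, Yv, ⟨0, hm⟩, hX, hY, hφX, hφY⟩
  refine ⟨fun hm2 => ⟨schur_even h2 hF D E, schur_odd hF hm2 D E⟩, fun hm1 => ?_⟩
  refine ⟨by rw [schur_even h2 hF D E, hm1]; rfl, ?_⟩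
  clear_value E D
  subst hm1
  exact schur_odd1 hF D E
end
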